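/- arXiv:1812.07392 — 4 statements merged into one kernel-verified Lean document; each statement's English description precedes it below -/
import Mathlib

section
/- Let Λ be a right 4-Nakayama artin algebra and let M be a finitely generated indecomposable 3-factor serial local right Λ-module whose socle is not simple. Then l(M) = 4, rad(M) = N ⊕ S1, where N is a uniserial submodule of length 2 and S1 is a simple submodule, and soc(M) = S1 ⊕ S2, where S2 = soc(N) is simple. -/
/-! Basic definitions for (right) modules over a ring: radical, socle, length,
uniserial, local, indecomposable, `n`-factor serial, right `n`-Nakayama algebras,
Nakayama algebras and almost split sequences. -/

universe u v w

section ModuleDefs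

variable (A : Type v) [Ring A] (M : Type w) [AddCommGroup M] [Module A M]

/-- The composition length of a module, i.e. the Krull dimension of its submodule lattice. -/
noncomputable def moduleLength : WithBot ℕ∞ := Order.krullDim (Submodule A M)

/-- The radical of a module: the intersection of all its maximal submodules. -/
def moduleRad : Submodule A M := sInf {N : Submodule A M | IsCoatom N}

/-- The socle of a module: the sum of all its simple submodules. -/
def moduleSoc : Submodule A M := sSup {N : Submodule A M | IsAtom N}

variable {A M}

/-- The radical of a submodule `N`, viewed as a submodule of the ambient module. -/
def radOf (N : Submodule A M) : Submodule A M :=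
  Submodule.map N.subtype (moduleRad A ↥N)

/-- The socle of a submodule `N`, viewed as a submodule of the ambient module. -/
def socOf (N : Submodule A M) : Submodule A M :=
  Submodule.map N.subtype (moduleSoc A ↥N)

variable (A M)

/-- The iterated radical `rad^n(M)`, as a submodule of `M`. -/
def radPow : ℕ → Submodule A M
  | 0 => ⊤
  | n + 1 => radOf (radPow n)

/-- A module is uniserial if its submodules are totally ordered by inclusion. -/
def IsUniserialModule : Prop := ∀ N P : Submodule A M, N ≤ P ∨ P ≤ N

/-- A module is local if it has a unique maximal submodule. -/
def IsLocalModule : Prop := ∃! N : Submodule A M, IsCoatom N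

/-- A module is colocal if its socle is a simple submodule. -/
def IsColocalModule : Prop := IsAtom (moduleSoc A M)

/-- A module is indecomposable if it is nonzero and is not the direct sum of two
nonzero submodules. -/
def IsIndecModule : Prop :=
  Nontrivial M ∧ ∀ N P : Submodule A M, IsCompl N P → N = ⊥ ∨ P = ⊥

/-- The Loewy length of a module: the least `n` with `rad^n(M) = 0`. -/
noncomputable def loewyLength : ℕ := sInf {n : ℕ | radPow A M n = ⊥}

/-- A module `M` of length `l` is `n`-factor serial (`l ≥ n > 1`) if it is not uniserial,
`M/rad^{l-n}(M)` is uniserial and `M/rad^{l-n+1}(M)` is not uniserial. -/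
def IsNFactorSerial (n : ℕ) : Prop :=
  1 < n ∧ ¬ IsUniserialModule A M ∧
  ∃ l : ℕ, moduleLength A M = l ∧ n ≤ l ∧
    IsUniserialModule A (M ⧸ radPow A M (l - n)) ∧
    ¬ IsUniserialModule A (M ⧸ radPow A M (l - n + 1))

/-- `M` is `n`-factor serial, where `1`-factor serial means uniserial. -/
def IsFactorSerial (n : ℕ) : Prop :=
  (n = 1 ∧ IsUniserialModule A M) ∨ IsNFactorSerial A M n

end ModuleDefs

section AlgebraDefs

variable (Λ : Type u) [Ring Λ]

/-- A ring `Λ` is right `n`-Nakayama if every finitely generated indecomposable right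
`Λ`-module is `i`-factor serial for some `1 ≤ i ≤ n`, and there is at least one finitely
generated indecomposable `n`-factor serial right `Λ`-module.  Right `Λ`-modules are
realized as left `Λᵐᵒᵖ`-modules. -/
def IsRightNNakayama (n : ℕ) : Prop :=
  (∀ M : ModuleCat.{u} Λᵐᵒᵖ, Module.Finite Λᵐᵒᵖ M → IsIndecModule Λᵐᵒᵖ M →
      ∃ i, 1 ≤ i ∧ i ≤ n ∧ IsFactorSerial Λᵐᵒᵖ M i) ∧
  ∃ M : ModuleCat.{u} Λᵐᵒᵖ, Module.Finite Λᵐᵒᵖ M ∧ IsIndecModule Λᵐᵒᵖ M ∧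
    IsNFactorSerial Λᵐᵒᵖ M n

/-- A ring `Λ` is a Nakayama algebra if every finitely generated indecomposable projective
right `Λ`-module and every finitely generated indecomposable projective left `Λ`-module is
uniserial. -/
def IsNakayamaAlgebra : Prop :=
  (∀ M : ModuleCat.{u} Λᵐᵒᵖ, Module.Finite Λᵐᵒᵖ M → Module.Projective Λᵐᵒᵖ M →
      IsIndecModule Λᵐᵒᵖ M → IsUniserialModule Λᵐᵒᵖ M) ∧
  (∀ M : ModuleCat.{u} Λ, Module.Finite Λ M → Module.Projective Λ M →
      IsIndecModule Λ M → IsUniserialModule Λ M)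

end AlgebraDefs

section AlmostSplit

variable {A : Type v} [Ring A]

/-- A pair of maps `f : X → Y`, `g : Y → Z` is an almost split (Auslander-Reiten) sequence
if `0 → X → Y → Z → 0` is a non-split short exact sequence with `X` and `Z` indecomposable,
such that every homomorphism `V → Z` from a finitely generated module which is not a split
epimorphism factors through `g`. -/
def IsAlmostSplitSequence {X Y Z : Type w} [AddCommGroup X] [Module A X]
    [AddCommGroup Y] [Module A Y] [AddCommGroup Z] [Module A Z]
    (f : X →ₗ[A] Y) (g : Y →ₗ[A] Z) : Prop :=
  Function.Injective f ∧ Function.Surjective g ∧ LinearMap.range f = LinearMap.ker g ∧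
  (¬ ∃ s : Z →ₗ[A] Y, g ∘ₗ s = LinearMap.id) ∧
  IsIndecModule A X ∧ IsIndecModule A Z ∧
  ∀ V : ModuleCat.{w} A, Module.Finite A V →
    ∀ h : V →ₗ[A] Z, (¬ ∃ s : Z →ₗ[A] V, h ∘ₗ s = LinearMap.id) →
      ∃ k : V →ₗ[A] Y, g ∘ₗ k = h

end AlmostSplit

section Radical

variable {A : Type*} [Ring A] {M : Type*} [AddCommGroup M] [Module A M]

/-- The submodules containing `K` are totally ordered. -/
def UniserialAbove (K : Submodule A M) : Prop :=
  ∀ U V : Submodule A M, K ≤ U → K ≤ V → U ≤ V ∨ V ≤ U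

theorem uniserialAbove_iff (K : Submodule A M) :
    UniserialAbove K ↔ IsUniserialModule A (M ⧸ K) := by
  constructor
  · intro h U V
    have := h (U.comap K.mkQ) (V.comap K.mkQ) (Submodule.le_comap_mkQ K U)
      (Submodule.le_comap_mkQ K V)
    simpa only [Submodule.comap_le_comap_iff_of_surjective K.mkQ_surjective] using this
  · intro h U V hU hV
    have := h (U.map K.mkQ) (V.map K.mkQ)
    simpa only [Submodule.map_le_iff_le_comap, Submodule.comap_map_mkQ, sup_eq_right.2 hU,
      sup_eq_right.2 hV] using this

theorem UniserialAbove.mono {K L : Submodule A M} (h : UniserialAbove K) (hKL : K ≤ L) :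
    UniserialAbove L :=
  fun U V hU hV => h U V (hKL.trans hU) (hKL.trans hV)

theorem UniserialAbove.map {M' : Type*} [AddCommGroup M'] [Module A M'] {K : Submodule A M}
    (h : UniserialAbove K) (f : M →ₗ[A] M') (hf : Function.Surjective f) :
    UniserialAbove (K.map f) := by
  intro U V hU hV
  have := h (U.comap f) (V.comap f) (Submodule.map_le_iff_le_comap.1 hU)
    (Submodule.map_le_iff_le_comap.1 hV)
  simpa only [Submodule.comap_le_comap_iff_of_surjective hf] using this

theorem UniserialAbove.comap {M' : Type*} [AddCommGroup M'] [Module A M'] {K : Submodule A M'}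
    (h : UniserialAbove K) (f : M →ₗ[A] M') (hf : Function.Surjective f) :
    UniserialAbove (K.comap f) := by
  intro U V hU hV
  have hk : LinearMap.ker f ≤ K.comap f := Submodule.comap_mono bot_le
  have := h (U.map f) (V.map f)
    (by rw [← Submodule.map_comap_eq_of_surjective hf K]; exact Submodule.map_mono hU)
    (by rw [← Submodule.map_comap_eq_of_surjective hf K]; exact Submodule.map_mono hV)
  simpa only [Submodule.map_le_iff_le_comap, Submodule.comap_map_eq,
    sup_eq_left.2 (hk.trans hU), sup_eq_left.2 (hk.trans hV)] using this

theorem Submodule.eq_of_le_sup_jacobson_smul [IsNoetherian A M] {V B : Submodule A M}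
    (hVB : V ≤ B) (h : B ≤ V ⊔ Ring.jacobson A • B) : V = B := by
  refine le_antisymm hVB ?_
  have : B.map V.mkQ = ⊥ := by
    refine Submodule.FG.eq_bot_of_le_jacobson_smul (IsNoetherian.noetherian _) ?_
    rw [← Submodule.map_smul'']
    refine (Submodule.map_mono h).trans ?_
    simp [Submodule.map_sup]
  simpa [Submodule.map_le_iff_le_comap, ← le_bot_iff] using this

theorem Submodule.jacobson_smul_ne_self [IsNoetherian A M] {B : Submodule A M} (hB : B ≠ ⊥) :
    Ring.jacobson A • B ≠ B :=
  fun h => hB (Submodule.FG.eq_bot_of_le_jacobson_smul (IsNoetherian.noetherian _) h.ge)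

theorem Submodule.jacobson_smul_eq_bot_of_isAtom {S : Submodule A M} (hS : IsAtom S) :
    Ring.jacobson A • S = ⊥ := by
  have : IsSimpleModule A S := isSimpleModule_iff_isAtom.2 hS
  rw [eq_bot_iff, Submodule.smul_le]
  intro r hr n hn
  have := Module.mem_annihilator.1
    (IsSemisimpleModule.jacobson_le_annihilator A S hr) ⟨n, hn⟩
  simpa using congrArg Subtype.val this

variable [IsArtinianRing A]

theorem isSemisimpleModule_of_jacobson_smul_eq_bot
    (h : Ring.jacobson A • (⊤ : Submodule A M) = ⊥) : IsSemisimpleModule A M := by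
  have hM : Module.IsTorsionBySet A M (Ring.jacobson A) := by
    rintro x ⟨a, ha⟩
    have : a • x ∈ Ring.jacobson A • (⊤ : Submodule A M) :=
      Submodule.smul_mem_smul ha trivial
    rw [h] at this
    simpa using this
  let := hM.module
  exact (Module.IsTorsionBySet.isSemisimpleModule_iff hM).1 inferInstance

theorem moduleRad_eq_jacobson_smul : moduleRad A M = Ring.jacobson A • ⊤ := by
  refine le_antisymm ?_ (Ring.jacobson_smul_top_le A M)
  refine Module.jacobson_le_of_eq_bot ?_
  have : IsSemisimpleModule A (M ⧸ (Ring.jacobson A • ⊤ : Submodule A M)) := by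
    apply isSemisimpleModule_of_jacobson_smul_eq_bot
    have := Submodule.mkQ_map_self (Ring.jacobson A • ⊤ : Submodule A M)
    rwa [Submodule.map_smul'', Submodule.map_top, Submodule.range_mkQ] at this
  exact IsSemisimpleModule.jacobson_eq_bot _ _

theorem radOf_eq_jacobson_smul (N : Submodule A M) : radOf N = Ring.jacobson A • N := by
  rw [radOf, moduleRad_eq_jacobson_smul, Submodule.map_smul'', Submodule.map_top,
    Submodule.range_subtype]

theorem radPow_succ_eq (n : ℕ) : radPow A M (n + 1) = Ring.jacobson A • radPow A M n :=
  radOf_eq_jacobson_smul _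

theorem Submodule.isSemisimpleModule_of_jacobson_smul {K : Submodule A M}
    (h : Ring.jacobson A • K = ⊥) : IsSemisimpleModule A K := by
  apply isSemisimpleModule_of_jacobson_smul_eq_bot
  apply Submodule.map_injective_of_injective K.injective_subtype
  rw [Submodule.map_smul'', Submodule.map_top, Submodule.range_subtype, h, Submodule.map_bot]

/-- Relative complements inside a submodule annihilated by the Jacobson radical. -/
theorem Submodule.exists_compl_of_jacobson_smul_eq_bot {B V : Submodule A M}
    (h : Ring.jacobson A • B = ⊥) (hVB : V ≤ B) :
    ∃ W ≤ B, W ⊓ V = ⊥ ∧ W ⊔ V = B := by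
  have := Submodule.isSemisimpleModule_of_jacobson_smul h
  obtain ⟨W, hW⟩ := ComplementedLattice.exists_isCompl (Submodule.submoduleOf V B)
  have hV : (Submodule.submoduleOf V B).map B.subtype = V := by
    rw [Submodule.submoduleOf, Submodule.map_comap_subtype, inf_eq_right.2 hVB]
  refine ⟨W.map B.subtype, Submodule.map_subtype_le B W, ?_, ?_⟩
  · rw [← hV, ← Submodule.map_inf _ B.injective_subtype, hW.symm.inf_eq_bot, Submodule.map_bot]
  · rw [← hV, ← Submodule.map_sup, hW.symm.sup_eq_top, Submodule.map_top,
      Submodule.range_subtype]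

theorem Submodule.exists_compl_above_jacobson_smul {B V : Submodule A M}
    (hV : Ring.jacobson A • B ≤ V) (hVB : V ≤ B) :
    ∃ W ≤ B, Ring.jacobson A • B ≤ W ∧ W ⊓ V = Ring.jacobson A • B ∧ W ⊔ V = B := by
  set K := Ring.jacobson A • B with hK
  obtain ⟨W, hWB, h1, h2⟩ := Submodule.exists_compl_of_jacobson_smul_eq_bot
    (B := B.map K.mkQ) (V := V.map K.mkQ)
    (by rw [← Submodule.map_smul'', ← hK, Submodule.mkQ_map_self]) (Submodule.map_mono hVB)
  have e : ∀ U : Submodule A M, K ≤ U → (U.map K.mkQ).comap K.mkQ = U := fun U hU => by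
    rw [Submodule.comap_map_mkQ, sup_eq_right.2 hU]
  refine ⟨W.comap K.mkQ, ?_, Submodule.le_comap_mkQ K W, ?_, ?_⟩
  · rw [← e B (hV.trans hVB)]; exact Submodule.comap_mono hWB
  · rw [← e V hV, ← Submodule.comap_inf, h1, Submodule.comap_bot, Submodule.ker_mkQ]
  · rw [← e (W.comap K.mkQ ⊔ V) (le_sup_of_le_right hV), Submodule.map_sup,
      Submodule.map_comap_eq_of_surjective K.mkQ_surjective, h2, e B (hV.trans hVB)]

theorem UniserialAbove.le_or_le_sup {B : Submodule A M}
    (h : UniserialAbove (Ring.jacobson A • B)) (V : Submodule A M) :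
    V ≤ Ring.jacobson A • B ∨ B ≤ V ⊔ Ring.jacobson A • B := by
  have hKB : Ring.jacobson A • B ≤ B := Submodule.smul_le_right
  rcases h (V ⊔ Ring.jacobson A • B) B le_sup_right hKB with hVB | hBV
  · obtain ⟨W, hWB, hKW, h1, h2⟩ :=
      Submodule.exists_compl_above_jacobson_smul le_sup_right hVB
    rcases h W (V ⊔ Ring.jacobson A • B) hKW le_sup_right with h3 | h3
    · exact Or.inr (h2.symm.le.trans (sup_le h3 le_rfl))
    · left; rw [← h1, inf_eq_right.2 h3]; exact le_sup_left
  · exact Or.inr hBV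

/-- If `M/JB` is uniserial and `J²B = 0`, a submodule not contained in `JB` has radical
containing `JB`. -/
theorem UniserialAbove.le_or_jacobson_smul_le {B : Submodule A M}
    (h : UniserialAbove (Ring.jacobson A • B))
    (hB : Ring.jacobson A • Ring.jacobson A • B = ⊥) (V : Submodule A M) :
    V ≤ Ring.jacobson A • B ∨ Ring.jacobson A • B ≤ Ring.jacobson A • V := by
  refine (h.le_or_le_sup V).imp_right fun h1 => ?_
  refine (smul_mono_right _ h1).trans ?_
  rw [Submodule.smul_sup, hB, sup_bot_eq]

theorem UniserialAbove.of_isAtom_or_eq_bot {B : Submodule A M}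
    (h : UniserialAbove (Ring.jacobson A • B))
    (hB : Ring.jacobson A • Ring.jacobson A • B = ⊥)
    (hK : Ring.jacobson A • B = ⊥ ∨ IsAtom (Ring.jacobson A • B)) :
    UniserialAbove (⊥ : Submodule A M) := by
  have key : ∀ V, V = ⊥ ∨ Ring.jacobson A • B ≤ V := fun V => by
    rcases h.le_or_jacobson_smul_le hB V with h1 | h1
    · rcases hK with h2 | h2
      · right; rw [h2]; exact bot_le
      · exact (h2.le_iff.1 h1).imp_right fun h3 => h3.ge
    · exact Or.inr (h1.trans Submodule.smul_le_right)
  intro U V _ _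
  rcases key U with rfl | hU
  · exact Or.inl bot_le
  rcases key V with rfl | hV
  · exact Or.inr bot_le
  exact h U V hU hV

end Radical

section Pushout

/-- Every finitely generated indecomposable module whose top is not uniserial has length at
most `n`. -/
def NonlocalLengthLE (A : Type u) [Ring A] (n : ℕ) : Prop :=
  ∀ (X : Type u) [AddCommGroup X] [Module A X], Module.Finite A X → IsIndecModule A X →
    ¬ UniserialAbove (Ring.jacobson A • ⊤ : Submodule A X) → Module.length A X ≤ n

variable {A : Type u} [Ring A]

theorem Ideal.smul_top_prod {P Q : Type*} [AddCommGroup P] [Module A P] [AddCommGroup Q]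
    [Module A Q] (I : Ideal A) :
    I • (⊤ : Submodule A (P × Q)) = (I • (⊤ : Submodule A P)).prod (I • (⊤ : Submodule A Q)) := by
  apply le_antisymm
  · rw [Submodule.smul_le]
    rintro r hr ⟨p, q⟩ -
    exact ⟨Submodule.smul_mem_smul hr trivial, Submodule.smul_mem_smul hr trivial⟩
  · rintro ⟨p, q⟩ ⟨hp, hq⟩
    have h1 : (I • (⊤ : Submodule A P)).map (LinearMap.inl A P Q) ≤ I • ⊤ := by
      rw [Submodule.map_smul'']; exact smul_mono_right _ le_top
    have h2 : (I • (⊤ : Submodule A Q)).map (LinearMap.inr A P Q) ≤ I • ⊤ := by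
      rw [Submodule.map_smul'']; exact smul_mono_right _ le_top
    have := add_mem (h1 (Submodule.mem_map_of_mem hp)) (h2 (Submodule.mem_map_of_mem hq))
    simpa using this

theorem Ideal.smul_top_eq_map_of_surjective {P Q : Type*} [AddCommGroup P] [Module A P]
    [AddCommGroup Q] [Module A Q] (I : Ideal A) (f : P →ₗ[A] Q) (hf : Function.Surjective f) :
    (I • ⊤ : Submodule A Q) = (I • ⊤ : Submodule A P).map f := by
  rw [Submodule.map_smul'', Submodule.map_top, LinearMap.range_eq_top.2 hf]

/-- A quotient of a product of two nonzero modules by a submodule of the radical does not have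
uniserial top. -/
theorem not_uniserialAbove_jacobson_smul_top_prod_quotient {P Q : Type*} [AddCommGroup P]
    [Module A P] [AddCommGroup Q] [Module A Q] [IsNoetherian A P] [IsNoetherian A Q]
    [Nontrivial P] [Nontrivial Q] {G : Submodule A (P × Q)} (hG : G ≤ Ring.jacobson A • ⊤) :
    ¬ UniserialAbove (Ring.jacobson A • ⊤ : Submodule A ((P × Q) ⧸ G)) := by
  intro h
  have hP : Ring.jacobson A • (⊤ : Submodule A P) ≠ ⊤ :=
    Submodule.jacobson_smul_ne_self top_ne_bot
  have hQ : Ring.jacobson A • (⊤ : Submodule A Q) ≠ ⊤ :=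
    Submodule.jacobson_smul_ne_self top_ne_bot
  have h' := h.comap G.mkQ G.mkQ_surjective
  rw [Ideal.smul_top_eq_map_of_surjective _ G.mkQ G.mkQ_surjective, Submodule.comap_map_mkQ,
    sup_eq_right.2 hG, Ideal.smul_top_prod] at h'
  rcases h' (Submodule.prod ⊤ (Ring.jacobson A • ⊤)) (Submodule.prod (Ring.jacobson A • ⊤) ⊤)
    (Submodule.prod_mono le_top le_rfl) (Submodule.prod_mono le_rfl le_top) with h1 | h1
  · refine hP (eq_top_iff.2 fun x _ => ?_)
    exact (h1 (x := (x, 0)) ⟨trivial, zero_mem _⟩).1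
  · refine hQ (eq_top_iff.2 fun x _ => ?_)
    exact (h1 (x := (0, x)) ⟨zero_mem _, trivial⟩).2

theorem Submodule.map_subtype_smul_top {P : Type*} [AddCommGroup P] [Module A P] (I : Ideal A)
    (B : Submodule A P) : (I • ⊤ : Submodule A B).map B.subtype = I • B := by
  rw [Submodule.map_smul'', Submodule.map_top, Submodule.range_subtype]

theorem Submodule.exists_smul_eq_of_mem_smul_span {P : Type*} [AddCommGroup P] [Module A P]
    {I : Ideal A} [I.IsTwoSided] {b x : P} (h : x ∈ I • Submodule.span A {b}) :
    ∃ j ∈ I, j • b = x :=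
  Submodule.mem_smul_span_singleton.1 h

theorem UniserialAbove.bot_of_nonlocalLengthLE [IsArtinianRing A] (hA : NonlocalLengthLE A 4)
    {M : Type u} [AddCommGroup M] [Module A M] [Module.Finite A M] {B : Submodule A M}
    (hBJ : B ≤ Ring.jacobson A • ⊤) (hB : Ring.jacobson A • Ring.jacobson A • B = ⊥)
    (h : UniserialAbove (Ring.jacobson A • B)) : UniserialAbove (⊥ : Submodule A M) := by
  have : IsArtinian A M := inferInstance
  have : IsNoetherian A M := inferInstance
  by_contra hbot
  have hK : ¬ (Ring.jacobson A • B = ⊥ ∨ IsAtom (Ring.jacobson A • B)) :=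
    fun hK => hbot (h.of_isAtom_or_eq_bot hB hK)
  push Not at hK
  obtain ⟨hK0, hKatom⟩ := hK
  have hB0 : B ≠ ⊥ := by rintro rfl; simp at hK0
  have hKB : Ring.jacobson A • B < B :=
    lt_of_le_of_ne Submodule.smul_le_right (Submodule.jacobson_smul_ne_self hB0)
  have hsoc := h.le_or_jacobson_smul_le hB
  set K := Ring.jacobson A • B with hKdef
  obtain ⟨S, hS, hSK⟩ := (eq_bot_or_exists_atom_le K).resolve_left hK0
  have hSK' : S < K := lt_of_le_of_ne hSK (by rintro rfl; exact hKatom hS)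
  obtain ⟨W, hWK, hWS, hWS'⟩ := Submodule.exists_compl_of_jacobson_smul_eq_bot hB hSK
  have hMtop : (⊤ : Submodule A M) ≠ ⊥ := fun h0 =>
    hB0 (le_bot_iff.1 (h0 ▸ le_top))
  have hJM : UniserialAbove (Ring.jacobson A • (⊤ : Submodule A M)) :=
    h.mono (smul_mono_right _ le_top)
  have : Nontrivial B := Submodule.nontrivial_iff_ne_bot.2 hB0
  have : Nontrivial M := B.injective_subtype.nontrivial
  let G : Submodule A (M × B) := S.comap (LinearMap.fst A M B) ⊓
    W.comap (LinearMap.fst A M B + B.subtype ∘ₗ LinearMap.snd A M B)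
  have memG : ∀ (m : M) (b : B), (m, b) ∈ G ↔ m ∈ S ∧ m + (b : M) ∈ W := fun m b => Iff.rfl
  have memJB : ∀ b : B, b ∈ (Ring.jacobson A • ⊤ : Submodule A B) ↔ (b : M) ∈ K := fun b => by
    rw [hKdef, ← Submodule.map_subtype_smul_top (Ring.jacobson A) B, Submodule.mem_map]
    exact ⟨fun hb => ⟨b, hb, rfl⟩, fun ⟨c, hc, h⟩ => by rwa [← Subtype.ext h]⟩
  have hGJ : G ≤ Ring.jacobson A • ⊤ := by
    rintro ⟨m, b⟩ hmb
    rw [memG] at hmb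
    rw [Ideal.smul_top_prod]
    refine ⟨hBJ (hKB.le (hSK hmb.1)), (memJB b).2 ?_⟩
    simpa using sub_mem (hWK hmb.2) (hSK hmb.1)
  let q : M →ₗ[A] (M × B) ⧸ G := G.mkQ ∘ₗ LinearMap.inl A M B
  have hqinj : Function.Injective q := by
    rw [← LinearMap.ker_eq_bot, eq_bot_iff]
    intro m hm
    have : (m, (0 : B)) ∈ G := (Submodule.Quotient.mk_eq_zero G).1 hm
    rw [memG] at this
    have := (show m ∈ W ⊓ S from ⟨by simpa using this.2, this.1⟩)
    rwa [hWS] at this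
  have hJX : (Ring.jacobson A • ⊤ : Submodule A ((M × B) ⧸ G)) =
      (Ring.jacobson A • ⊤ : Submodule A M).map q := by
    apply le_antisymm
    · rw [Ideal.smul_top_eq_map_of_surjective _ G.mkQ G.mkQ_surjective, Ideal.smul_top_prod]
      rintro _ ⟨⟨m, b⟩, ⟨hm, hb⟩, rfl⟩
      have hbK : (b : M) ∈ K := (memJB b).1 hb
      rw [← hWS', Submodule.mem_sup] at hbK
      obtain ⟨w, hw, s, hs, hws⟩ := hbK
      refine ⟨m + s, add_mem hm (hBJ (hKB.le (hSK hs))), ?_⟩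
      refine (Submodule.Quotient.eq G).2 ?_
      show ((m + s) - m, (0 : B) - b) ∈ G
      rw [memG]
      refine ⟨by simpa using hs, ?_⟩
      have : (m + s) - m + (((0 : B) - b : B) : M) = - w := by
        rw [AddSubgroupClass.coe_sub, ← hws]; simp
      rw [this]; exact neg_mem hw
    · rw [Submodule.map_smul'']; exact smul_mono_right _ le_top
  have hnon := not_uniserialAbove_jacobson_smul_top_prod_quotient hGJ
  have hlen : (5 : ℕ∞) ≤ Module.length A ((M × B) ⧸ G) := by
    have hq : StrictMono (Submodule.map q) := Submodule.map_strictMono_of_injective hqinj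
    have c1 := Order.height_add_one_le (hq hS.bot_lt)
    have c2 := Order.height_add_one_le (hq hSK')
    have c3 := Order.height_add_one_le (hq hKB)
    have c4 := Order.height_add_one_le (hq (lt_of_le_of_lt hBJ
      (lt_top_iff_ne_top.2 (Submodule.jacobson_smul_ne_self hMtop))))
    have hlt : Submodule.map q ⊤ < ⊤ := by
      rw [lt_top_iff_ne_top]
      intro htop
      refine hKB.not_ge fun b hb => ?_
      have : G.mkQ (0, ⟨b, hb⟩) ∈ Submodule.map q ⊤ := htop ▸ trivial
      obtain ⟨m, -, hm⟩ := this
      have := (Submodule.Quotient.eq G).1 hm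
      change (m - 0, (0 : B) - ⟨b, hb⟩) ∈ G at this
      rw [memG] at this
      have := sub_mem (hSK this.1) (hWK this.2)
      simpa using this
    have c5 := Order.height_add_one_le hlt
    rw [Module.length_eq_height]
    refine le_trans ?_ c5
    refine le_trans ?_ (add_le_add_left c4 1)
    refine le_trans ?_ (add_le_add_left (add_le_add_left c3 1) 1)
    refine le_trans ?_ (add_le_add_left (add_le_add_left (add_le_add_left c2 1) 1) 1)
    refine le_trans ?_ (add_le_add_left (add_le_add_left (add_le_add_left
      (add_le_add_left c1 1) 1) 1) 1)
    rw [add_assoc, add_assoc, add_assoc, add_assoc]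
    exact le_add_left (by norm_num)
  have hhollow : ∀ U V : Submodule A M, U ⊔ V = Ring.jacobson A • ⊤ →
      U = Ring.jacobson A • ⊤ ∨ V = Ring.jacobson A • ⊤ := by
    have key : ∀ U V : Submodule A M, U ⊔ V = Ring.jacobson A • ⊤ → U ⊔ K ≤ V ⊔ K →
        V = Ring.jacobson A • ⊤ := by
      intro U V hUV hle
      refine Submodule.eq_of_le_sup_jacobson_smul (hUV ▸ le_sup_right) ?_
      calc Ring.jacobson A • ⊤ = U ⊔ V := hUV.symm
        _ ≤ V ⊔ K := sup_le (le_sup_left.trans hle) le_sup_left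
        _ ≤ _ := sup_le_sup_left (smul_mono_right _ hBJ) _
    intro U V hUV
    rcases h (U ⊔ K) (V ⊔ K) le_sup_right le_sup_right with h1 | h1
    · exact Or.inr (key U V hUV h1)
    · exact Or.inl (key V U (sup_comm U V ▸ hUV) h1)
  have hmain : ∀ X₁ X₂ : Submodule A ((M × B) ⧸ G), X₁ ⊓ X₂ = ⊥ →
      Ring.jacobson A • X₁ = Ring.jacobson A • ⊤ → X₂ = ⊥ := by
    intro X₁ X₂ hdisj hX₁
    have hJX₂ : Ring.jacobson A • X₂ = ⊥ := by
      rw [eq_bot_iff, ← hdisj]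
      exact le_inf ((smul_mono_right _ le_top).trans (hX₁ ▸ Submodule.smul_le_right))
        Submodule.smul_le_right
    rw [eq_bot_iff]
    intro z hz
    by_contra hz0
    obtain ⟨⟨m, b⟩, rfl⟩ := G.mkQ_surjective z
    have hzJ : G.mkQ (m, b) ∉ (Ring.jacobson A • ⊤ : Submodule A ((M × B) ⧸ G)) := by
      intro hzJ
      refine hz0 ?_
      rw [← hdisj]
      exact ⟨(hX₁ ▸ Submodule.smul_le_right : Ring.jacobson A • ⊤ ≤ X₁) hzJ, hz⟩
    have hann : ∀ j ∈ Ring.jacobson A, (j • m, j • b) ∈ G := by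
      intro j hj
      have := Submodule.smul_mem_smul hj hz
      rw [hJX₂] at this
      exact (Submodule.Quotient.mk_eq_zero G).1 this
    have hJm : Ring.jacobson A • Submodule.span A {m} ≤ S := by
      intro x hx
      obtain ⟨j, hj, rfl⟩ := Submodule.exists_smul_eq_of_mem_smul_span hx
      exact ((memG _ _).1 (hann j hj)).1
    have hmJ : m ∈ (Ring.jacobson A • ⊤ : Submodule A M) := by
      rcases hJM.le_or_le_sup (Submodule.span A {m}) with h1 | h1
      · exact h1 (Submodule.mem_span_singleton_self m)
      · exfalso
        have := Submodule.eq_of_le_sup_jacobson_smul le_top h1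
        rw [this] at hJm
        exact hSK'.not_ge ((hKB.le.trans hBJ).trans hJm)
    have hbK : (b : M) ∉ K := by
      intro hbK
      refine hzJ ?_
      rw [Ideal.smul_top_eq_map_of_surjective _ G.mkQ G.mkQ_surjective, Ideal.smul_top_prod]
      exact Submodule.mem_map_of_mem ⟨hmJ, (memJB b).2 hbK⟩
    have hKb : K ≤ Ring.jacobson A • Submodule.span A {(b : M)} :=
      (hsoc _).resolve_left fun h1 => hbK (h1 (Submodule.mem_span_singleton_self _))
    have hmK : m ∈ K := by
      rcases hsoc (Submodule.span A {m}) with h1 | h1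
      · exact h1 (Submodule.mem_span_singleton_self m)
      · exact absurd (h1.trans hJm) hSK'.not_ge
    refine hS.1 (eq_bot_iff.2 fun s hs => ?_)
    obtain ⟨j, hj, hjb⟩ := Submodule.exists_smul_eq_of_mem_smul_span (hKb (hSK hs))
    have hjm : j • m = 0 := by
      have := Submodule.smul_mem_smul hj hmK
      rwa [hB] at this
    have := ((memG _ _).1 (hann j hj)).2
    rw [hjm, zero_add, Submodule.coe_smul, hjb] at this
    rw [← hWS]
    exact ⟨this, hs⟩
  have hindec : IsIndecModule A ((M × B) ⧸ G) := by
    refine ⟨hqinj.nontrivial, fun X₁ X₂ hX => ?_⟩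
    have hsup : Ring.jacobson A • X₁ ⊔ Ring.jacobson A • X₂ = Ring.jacobson A • ⊤ := by
      rw [← Submodule.smul_sup, hX.sup_eq_top]
    have hcm : ∀ Y : Submodule A ((M × B) ⧸ G), Ring.jacobson A • Y ≤ Ring.jacobson A • ⊤ →
        (Submodule.comap q (Ring.jacobson A • Y)).map q = Ring.jacobson A • Y := fun Y hY => by
      rw [Submodule.map_comap_eq, inf_eq_right.2]
      rw [hJX] at hY
      exact hY.trans LinearMap.map_le_range
    have e1 := hcm X₁ (smul_mono_right _ le_top)
    have e2 := hcm X₂ (smul_mono_right _ le_top)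
    rcases hhollow (Submodule.comap q (Ring.jacobson A • X₁))
      (Submodule.comap q (Ring.jacobson A • X₂)) (by
        apply Submodule.map_injective_of_injective hqinj
        rw [Submodule.map_sup, e1, e2, hsup, hJX]) with h1 | h1
    · right
      refine hmain X₁ X₂ hX.inf_eq_bot ?_
      rw [← e1, h1, hJX]
    · left
      refine hmain X₂ X₁ hX.symm.inf_eq_bot ?_
      rw [← e2, h1, hJX]
  have := hlen.trans (hA _ inferInstance hindec hnon)
  exact absurd this (by decide)

end Pushout

section Nakayama

theorem IsRightNNakayama.nonlocalLengthLE {Λ : Type u} [Ring Λ] [IsArtinianRing Λᵐᵒᵖ] {n : ℕ}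
    (h : IsRightNNakayama Λ n) : NonlocalLengthLE Λᵐᵒᵖ n := by
  intro X _ _ hX hind hnon
  obtain ⟨i, -, hin, ⟨-, hi⟩ | ⟨-, -, l, hl, hil, huni, -⟩⟩ :=
    h.1 (ModuleCat.of Λᵐᵒᵖ X) hX hind
  · exact absurd (fun U V _ _ => hi U V) hnon
  · have hli : l = i := by
      by_contra hne
      obtain ⟨k, hk⟩ : ∃ k, l - i = k + 1 := Nat.exists_eq_succ_of_ne_zero (by omega)
      rw [hk, ← uniserialAbove_iff, radPow_succ_eq] at huni
      exact hnon (huni.mono (smul_mono_right _ le_top))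
    rw [moduleLength, ← Module.coe_length] at hl
    have : Module.length Λᵐᵒᵖ X = l := WithBot.coe_injective hl
    rw [this, hli]
    exact_mod_cast hin

end Nakayama

section Hollow

/-- A module which is not the sum of two proper submodules. -/
def IsHollowModule (A : Type*) [Ring A] (M : Type*) [AddCommGroup M] [Module A M] : Prop :=
  ∀ U V : Submodule A M, U ⊔ V = ⊤ → U = ⊤ ∨ V = ⊤

section Basic

variable {A : Type*} [Ring A] {M : Type*} [AddCommGroup M] [Module A M]

theorem Ideal.smul_smul_top_prod_eq_bot {P : Type*} [AddCommGroup P] [Module A P] (I : Ideal A)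
    (hM : I • I • (⊤ : Submodule A M) = ⊥) (hP : I • I • (⊤ : Submodule A P) = ⊥) :
    I • I • (⊤ : Submodule A (M × P)) = ⊥ := by
  rw [Ideal.smul_top_prod, eq_bot_iff, ← Submodule.prod_bot, ← hM, ← hP, Submodule.smul_le]
  exact fun r hr p hp => ⟨Submodule.smul_mem_smul hr hp.1, Submodule.smul_mem_smul hr hp.2⟩

theorem IsHollowModule.of_linearEquiv {M' : Type*} [AddCommGroup M'] [Module A M']
    (h : IsHollowModule A M) (e : M ≃ₗ[A] M') : IsHollowModule A M' := by
  have key : ∀ U : Submodule A M', U.comap (e : M →ₗ[A] M') = ⊤ → U = ⊤ := fun U hU => by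
    rw [← Submodule.map_comap_eq_of_surjective (f := (e : M →ₗ[A] M')) e.surjective U, hU,
      Submodule.map_top, LinearEquiv.range]
  intro U V hUV
  refine (h (U.comap (e : M →ₗ[A] M')) (V.comap (e : M →ₗ[A] M')) ?_).imp (key U) (key V)
  apply Submodule.map_injective_of_injective (f := (e : M →ₗ[A] M')) e.injective
  rw [Submodule.map_sup, Submodule.map_comap_eq_of_surjective e.surjective,
    Submodule.map_comap_eq_of_surjective e.surjective, hUV, Submodule.map_top, LinearEquiv.range]

theorem UniserialAbove.isHollowModule [IsArtinianRing A] [IsNoetherian A M]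
    (h : UniserialAbove (Ring.jacobson A • ⊤ : Submodule A M)) : IsHollowModule A M := by
  intro U V hUV
  rcases h.le_or_le_sup U with h1 | h1
  · right
    refine Submodule.eq_of_le_sup_jacobson_smul le_top ?_
    rw [← hUV]
    refine sup_le (h1.trans ?_) le_sup_left
    rw [hUV]; exact le_sup_right
  · exact Or.inl (Submodule.eq_of_le_sup_jacobson_smul le_top h1)

theorem IsHollowModule.le_or_eq_top [IsArtinianRing A] (h : IsHollowModule A M)
    (V : Submodule A M) : V ≤ Ring.jacobson A • ⊤ ∨ V = ⊤ := by
  rw [← moduleRad_eq_jacobson_smul, or_iff_not_imp_left, moduleRad, le_sInf_iff]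
  intro hV
  push Not at hV
  obtain ⟨C, hC, hVC⟩ := hV
  exact (h V C (hC.2 _ (right_lt_sup.2 hVC))).resolve_right hC.1

theorem IsHollowModule.bijective_or_range_le [IsArtinianRing A] [IsNoetherian A M]
    (h : IsHollowModule A M) (γ : M →ₗ[A] M) :
    Function.Bijective γ ∨ LinearMap.range γ ≤ Ring.jacobson A • ⊤ :=
  (h.le_or_eq_top (LinearMap.range γ)).symm.imp_left fun h1 =>
    IsNoetherian.bijective_of_surjective_endomorphism γ (LinearMap.range_eq_top.1 h1)

theorem IsHollowModule.bijective_or_eq_zero [IsArtinianRing A] [IsNoetherian A M]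
    (h : IsHollowModule A M) (hJ : Ring.jacobson A • Ring.jacobson A • (⊤ : Submodule A M) = ⊥)
    (γ : M →ₗ[A] M) :
    Function.Bijective γ ∨ ∀ k ∈ (Ring.jacobson A • ⊤ : Submodule A M), γ k = 0 := by
  refine (h.bijective_or_range_le γ).imp_right fun h1 k hk => ?_
  have h2 := Submodule.mem_map_of_mem (f := γ) hk
  rw [Submodule.map_smul'', Submodule.map_top] at h2
  have h3 := smul_mono_right (Ring.jacobson A) h1 h2
  rwa [hJ] at h3

end Basic

variable {A : Type u} [Ring A]

/-- Every hollow module of Loewy length at most two is covered by one which is projective with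
respect to modules of Loewy length at most two. -/
theorem IsHollowModule.exists_cover [IsArtinianRing A] {M : Type u} [AddCommGroup M] [Module A M]
    [Module.Finite A M] [Nontrivial M] (hM : IsHollowModule A M)
    (hJ : Ring.jacobson A • Ring.jacobson A • (⊤ : Submodule A M) = ⊥) :
    ∃ I : Ideal A, IsHollowModule A (A ⧸ I) ∧
      Ring.jacobson A • Ring.jacobson A • (⊤ : Submodule A (A ⧸ I)) = ⊥ ∧
      (∃ f : A ⧸ I →ₗ[A] M, Function.Surjective f) ∧
      ∀ (Z W : Type u) [AddCommGroup Z] [Module A Z] [AddCommGroup W] [Module A W],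
        Module.Finite A Z → Ring.jacobson A • Ring.jacobson A • (⊤ : Submodule A Z) = ⊥ →
        ∀ (g : Z →ₗ[A] W) (h : A ⧸ I →ₗ[A] W), Function.Surjective g →
          ∃ h' : A ⧸ I →ₗ[A] Z, g ∘ₗ h' = h := by
  have hann : ∀ {P : Type u} [AddCommGroup P] [Module A P],
      Ring.jacobson A • Ring.jacobson A • (⊤ : Submodule A P) = ⊥ → ∀ p : P,
      Ring.jacobson A • Ring.jacobson A • (⊤ : Submodule A A) ≤
        LinearMap.ker (LinearMap.toSpanSingleton A P p) := by
    intro P _ _ hP p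
    rw [LinearMap.le_ker_iff_map, Submodule.map_smul'', Submodule.map_smul'', ← le_bot_iff, ← hP]
    exact smul_mono_right _ (smul_mono_right _ le_top)
  obtain ⟨x, -, hx⟩ := SetLike.exists_of_lt
    (lt_top_iff_ne_top.2 (Submodule.jacobson_smul_ne_self (A := A) (M := M) top_ne_bot))
  have hxM : Function.Surjective (LinearMap.toSpanSingleton A M x) := by
    rw [← LinearMap.range_eq_top]
    exact (hM.le_or_eq_top _).resolve_left fun h => hx (h ⟨1, by simp⟩)
  obtain ⟨I, ⟨hI1, hI2, hI3⟩, hImin⟩ := IsArtinian.set_has_minimal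
    {I : Submodule A A | Ring.jacobson A • Ring.jacobson A • (⊤ : Submodule A A) ≤ I ∧
      I ≤ LinearMap.ker (LinearMap.toSpanSingleton A M x) ∧ IsHollowModule A (A ⧸ I)}
    ⟨_, hann hJ x, le_rfl, hM.of_linearEquiv
      (LinearMap.quotKerEquivOfSurjective _ hxM).symm⟩
  have hJI : Ring.jacobson A • Ring.jacobson A • (⊤ : Submodule A (A ⧸ I)) = ⊥ := by
    rw [← LinearMap.range_eq_top.2 (Submodule.mkQ_surjective I), ← Submodule.map_top,
      ← Submodule.map_smul'', ← Submodule.map_smul'', eq_bot_iff]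
    exact (Submodule.map_mono hI1).trans (Submodule.mkQ_map_self I).le
  refine ⟨I, hI3, hJI, ⟨I.liftQ _ hI2, ?_⟩, ?_⟩
  · rw [← LinearMap.range_eq_top, Submodule.range_liftQ, LinearMap.range_eq_top]
    exact hxM
  intro Z W _ _ _ _ hZ hJZ g h hg
  have : IsArtinian A (Z × (A ⧸ I)) := inferInstance
  obtain ⟨Q, ⟨hQ1, hQ2⟩, hQmin⟩ := IsArtinian.set_has_minimal
    {Q : Submodule A (Z × (A ⧸ I)) |
      Q ≤ LinearMap.eqLocus (g ∘ₗ LinearMap.fst A Z (A ⧸ I)) (h ∘ₗ LinearMap.snd A Z (A ⧸ I)) ∧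
      Q.map (LinearMap.snd A Z (A ⧸ I)) = ⊤}
    ⟨_, le_rfl, eq_top_iff.2 fun n _ => by
      obtain ⟨z, hz⟩ := hg (h n)
      exact ⟨(z, n), hz, rfl⟩⟩
  obtain ⟨⟨z, n⟩, hq, hn⟩ : Submodule.Quotient.mk (1 : A) ∈
    Q.map (LinearMap.snd A Z (A ⧸ I)) := hQ2 ▸ trivial
  obtain rfl : n = Submodule.Quotient.mk (1 : A) := hn
  set f := LinearMap.toSpanSingleton A (Z × (A ⧸ I)) (z, Submodule.Quotient.mk 1) with hf
  have hsnd : ∀ a : A, (f a).2 = Submodule.Quotient.mk a := fun a => by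
    rw [hf, LinearMap.toSpanSingleton_apply, Prod.smul_snd, ← Submodule.Quotient.mk_smul,
      smul_eq_mul, mul_one]
  have hfQ : LinearMap.range f = Q := by
    have hle : LinearMap.range f ≤ Q := by
      rintro _ ⟨a, rfl⟩
      exact Q.smul_mem a hq
    refine hle.eq_of_not_lt (hQmin _ ⟨hle.trans hQ1, eq_top_iff.2 fun n _ => ?_⟩)
    obtain ⟨a, rfl⟩ := Submodule.Quotient.mk_surjective I n
    exact ⟨f a, ⟨a, rfl⟩, hsnd a⟩
  subst hfQ
  have hker : LinearMap.ker f ≤ I := fun a ha => by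
    rw [← Submodule.Quotient.mk_eq_zero I, ← hsnd, LinearMap.mem_ker.1 ha, Prod.snd_zero]
  have hhol : IsHollowModule A (LinearMap.range f) := by
    have key : ∀ U : Submodule A (LinearMap.range f),
        U.map (LinearMap.snd A Z (A ⧸ I) ∘ₗ (LinearMap.range f).subtype) = ⊤ → U = ⊤ := by
      intro U hU
      have hle := Submodule.map_subtype_le (LinearMap.range f) U
      have := hle.eq_of_not_lt (hQmin _ ⟨hle.trans hQ1, by rw [← Submodule.map_comp, hU]⟩)
      apply Submodule.map_injective_of_injective (LinearMap.range f).injective_subtype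
      rw [this, Submodule.map_top, Submodule.range_subtype]
    intro U V hUV
    refine (hI3 _ _ ?_).imp (key U) (key V)
    rw [← Submodule.map_sup, hUV, Submodule.map_top, LinearMap.range_comp,
      Submodule.range_subtype, hQ2]
  have hkI : LinearMap.ker f = I := by
    refine hker.eq_of_not_lt (hImin _ ⟨hann ?_ _, hker.trans hI2,
      hhol.of_linearEquiv f.quotKerEquivRange.symm⟩)
    exact Ideal.smul_smul_top_prod_eq_bot _ hJZ hJI
  refine ⟨I.liftQ (LinearMap.toSpanSingleton A Z z) fun a ha => ?_, ?_⟩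
  · rw [← hkI] at ha
    exact congrArg Prod.fst (LinearMap.mem_ker.1 ha)
  · apply Submodule.linearMap_qext
    apply LinearMap.ext_ring
    have : g z = h (Submodule.Quotient.mk 1) := hQ1 hq
    change g ((1 : A) • z) = _
    rwa [one_smul]

end Hollow

section Atoms

variable {A : Type*} [Ring A] {N : Type*} [AddCommGroup N] [Module A N]

theorem Submodule.length_sup_le (U V : Submodule A N) :
    Module.length A ↥(U ⊔ V) ≤ Module.length A U + Module.length A V := by
  rw [← Module.length_prod]
  refine Module.length_le_of_surjective ((U.subtype.coprod V.subtype).codRestrict (U ⊔ V)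
    fun x => ?_) ?_
  · exact Submodule.add_mem_sup x.1.2 x.2.2
  · rintro ⟨x, hx⟩
    obtain ⟨u, hu, v, hv, rfl⟩ := Submodule.mem_sup.1 hx
    exact ⟨(⟨u, hu⟩, ⟨v, hv⟩), rfl⟩

theorem Submodule.length_eq_one_of_isAtom {T : Submodule A N} (hT : IsAtom T) :
    Module.length A T = 1 :=
  Module.length_eq_one_iff.2 (isSimpleModule_iff_isAtom.2 hT)

theorem Submodule.exists_isAtom_inf_eq_bot [IsArtinianRing A] [IsArtinian A N]
    {K V : Submodule A N} (hK : Ring.jacobson A • K = ⊥) (hVK : V < K) :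
    ∃ T ≤ K, IsAtom T ∧ T ⊓ V = ⊥ := by
  obtain ⟨W, hWK, hWV, hsup⟩ := Submodule.exists_compl_of_jacobson_smul_eq_bot hK hVK.le
  have hW : W ≠ ⊥ := by
    rintro rfl
    rw [bot_sup_eq] at hsup
    exact hVK.ne hsup
  obtain ⟨T, hT, hTW⟩ := (eq_bot_or_exists_atom_le W).resolve_left hW
  exact ⟨T, hTW.trans hWK, hT, le_bot_iff.1 (hWV ▸ inf_le_inf_right V hTW)⟩

theorem IsAtom.sup_lt_of_length {T₁ T₂ K : Submodule A N} (h₁ : IsAtom T₁) (h₂ : IsAtom T₂)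
    (h₁K : T₁ ≤ K) (h₂K : T₂ ≤ K) (hK : 3 ≤ Module.length A K) : T₁ ⊔ T₂ < K := by
  refine lt_of_le_of_ne (sup_le h₁K h₂K) ?_
  rintro rfl
  have := hK.trans (Submodule.length_sup_le T₁ T₂)
  rw [Submodule.length_eq_one_of_isAtom h₁, Submodule.length_eq_one_of_isAtom h₂] at this
  exact absurd this (by decide)

/-- In a module whose endomorphisms are bijective or vanish on a submodule `K` containing three
independent simple submodules, one can choose such submodules and a gluing map that no
endomorphism realises. -/
theorem exists_isAtom_forall_endomorphism {R : Type*} [CommRing R] [IsArtinianRing R]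
    [Algebra R A] [Module.Finite R A] [IsArtinianRing A] [Module R N] [IsScalarTower R A N]
    [IsArtinian A N] [IsNoetherian A N] {K : Submodule A N} (hJK : Ring.jacobson A • K = ⊥)
    (hK : 3 ≤ Module.length A K)
    (hend : ∀ γ : N →ₗ[A] N, Function.Bijective γ ∨ ∀ k ∈ K, γ k = 0) :
    ∃ T₁ ≤ K, ∃ T₂ ≤ K, ∃ T₃ ≤ K, IsAtom T₁ ∧ IsAtom T₂ ∧ IsAtom T₃ ∧ T₁ ⊓ T₂ = ⊥ ∧
      T₃ ⊓ (T₁ ⊔ T₂) = ⊥ ∧ ∃ f : T₃ →ₗ[A] N, (∀ t, f t ∈ K) ∧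
        ∀ γ : N →ₗ[A] N, (∀ t ∈ T₁, γ t ∈ T₂) → ¬ ∀ t : T₃, γ t - f t ∈ T₂ := by
  have hzero : ∀ γ : N →ₗ[A] N, ∀ x ∈ K, x ≠ 0 → γ x = 0 → ∀ k ∈ K, γ k = 0 :=
    fun γ x _ hx0 hγ => (hend γ).resolve_left fun hb =>
      hx0 (hb.1 (hγ.trans (map_zero γ).symm))
  by_cases hiso : ∀ T₁ ≤ K, ∀ T₂ ≤ K, IsAtom T₁ → IsAtom T₂ → Nonempty (T₁ ≃ₗ[A] T₂)
  · have hK0 : (⊥ : Submodule A N) < K := bot_lt_iff_ne_bot.2 <| by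
      rintro rfl
      rw [Module.length_bot] at hK
      exact absurd hK (by decide)
    obtain ⟨T₁, h₁K, h₁, -⟩ := Submodule.exists_isAtom_inf_eq_bot hJK hK0
    have h₁lt : T₁ < K := by
      simpa using h₁.sup_lt_of_length h₁ h₁K h₁K hK
    obtain ⟨T₂, h₂K, h₂, h₂₁⟩ := Submodule.exists_isAtom_inf_eq_bot hJK h₁lt
    rw [inf_comm] at h₂₁
    obtain ⟨T, hTK, hT, hT12⟩ := Submodule.exists_isAtom_inf_eq_bot hJK
      (h₁.sup_lt_of_length h₂ h₁K h₂K hK)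
    refine ⟨T₁, h₁K, T₂, h₂K, T, hTK, h₁, h₂, hT, h₂₁, hT12, ?_⟩
    obtain ⟨e₁⟩ := hiso T hTK T₁ h₁K hT h₁
    obtain ⟨e₂⟩ := hiso T hTK T₂ h₂K hT h₂
    by_contra! hcon
    obtain ⟨x, hxT, hx⟩ := T.exists_mem_ne_zero_of_ne_bot hT.1
    have : Module.Finite R T := Module.Finite.trans A T
    have : IsSimpleModule A T := isSimpleModule_iff_isAtom.2 hT
    have : IsNoetherian R (T →ₗ[A] T) := by
      let ev : (T →ₗ[A] T) →ₗ[R] T :=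
        { toFun := fun a => a ⟨x, hxT⟩
          map_add' := fun _ _ => rfl
          map_smul' := fun _ _ => rfl }
      refine isNoetherian_of_injective ev ((injective_iff_map_eq_zero ev).2 fun a ha => ?_)
      refine a.bijective_or_eq_zero.resolve_left fun hb => hx ?_
      exact congrArg Subtype.val (hb.1 (ha.trans (map_zero a).symm))
    let W : Submodule R ((T →ₗ[A] T) × (T →ₗ[A] T) × (T →ₗ[A] T)) :=
      { carrier := {w | ∃ γ : N →ₗ[A] N, (∀ t, γ (e₁ t) = e₂ (w.2.2 t)) ∧
          ∀ t : T, γ t - (e₁ (w.1 t) + w.2.1 t : N) ∈ T₂}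
        zero_mem' := ⟨0, by simp, by simp⟩
        add_mem' := by
          rintro w w' ⟨γ, h, h'⟩ ⟨δ, k, k'⟩
          refine ⟨γ + δ, fun t => ?_, fun t => ?_⟩
          · simp [h, k]
          · convert add_mem (h' t) (k' t) using 1
            simp only [LinearMap.add_apply, Prod.fst_add, Prod.snd_add, map_add,
              Submodule.coe_add]
            abel
        smul_mem' := by
          have hsmul : ∀ {P : Submodule A N} (e : T ≃ₗ[A] P) (r : R) (t : T),
              (e (r • t) : N) = r • (e t : N) := fun e r t => by
            rw [← algebraMap_smul A r t, map_smul, Submodule.coe_smul, algebraMap_smul]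
          rintro r w ⟨γ, h, h'⟩
          refine ⟨r • γ, fun t => ?_, fun t => ?_⟩
          · simp only [LinearMap.smul_apply, Prod.smul_snd, hsmul, h]
          · convert T₂.smul_of_tower_mem r (h' t) using 1
            simp only [LinearMap.smul_apply, Prod.smul_fst, Prod.smul_snd, hsmul, smul_sub,
              smul_add, Submodule.coe_smul_of_tower] }
    let s : W →ₗ[R] (T →ₗ[A] T) := LinearMap.snd R _ _ ∘ₗ LinearMap.snd R _ _ ∘ₗ W.subtype
    let a : W →ₗ[R] (T →ₗ[A] T) := LinearMap.fst R _ _ ∘ₗ W.subtype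
    have hs : Function.Injective s := by
      suffices ∀ w ∈ W, w.2.2 = 0 → w = 0 from fun w w' hw =>
        Subtype.ext (sub_eq_zero.1 (this _ (W.sub_mem w.2 w'.2) (sub_eq_zero.2 hw)))
      rintro ⟨a, b, c⟩ ⟨γ, h, h'⟩ (rfl : c = 0)
      have hk := hzero γ (e₁ ⟨x, hxT⟩) (h₁K (e₁ _).2) (by simpa using hx) (by rw [h]; simp)
      have hab : ∀ t : T, a t = 0 ∧ b t = 0 := fun t => by
        have h'' : (e₁ (a t) + b t : N) ∈ T₂ := by
          have := h' t
          rwa [hk t (hTK t.2), zero_sub, neg_mem_iff] at this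
        have hb : (b t : N) = 0 := by
          have : (b t : N) ∈ T ⊓ (T₁ ⊔ T₂) := by
            refine ⟨(b t).2, ?_⟩
            rw [← add_sub_cancel_left (e₁ (a t) : N) (b t : N)]
            exact sub_mem (le_sup_right (a := T₁) h'') (le_sup_left (b := T₂) (e₁ (a t)).2)
          rwa [hT12] at this
        have ha : (e₁ (a t) : N) = 0 := by
          rw [hb, add_zero] at h''
          have : (e₁ (a t) : N) ∈ T₁ ⊓ T₂ := ⟨(e₁ (a t)).2, h''⟩
          rwa [h₂₁] at this
        exact ⟨by simpa using ha, by simpa using hb⟩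
      obtain rfl : a = 0 := LinearMap.ext fun t => (hab t).1
      obtain rfl : b = 0 := LinearMap.ext fun t => (hab t).2
      rfl
    have hW : ∀ a b : T →ₗ[A] T, ∃ w : W, w.1.1 = a ∧ w.1.2.1 = b := fun a b => by
      obtain ⟨γ, hγ, hγ'⟩ := hcon (T₁.subtype ∘ₗ (e₁ : T →ₗ[A] T₁) ∘ₗ a + T.subtype ∘ₗ b)
        fun t => add_mem (h₁K (e₁ (a t)).2) (hTK (b t).2)
      refine ⟨⟨⟨a, b, (e₂.symm : T₂ →ₗ[A] T) ∘ₗ γ.restrict hγ ∘ₗ (e₁ : T →ₗ[A] T₁)⟩,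
        γ, fun t => ?_, hγ'⟩, rfl, rfl⟩
      simp
    have ha : Function.Injective a :=
      IsNoetherian.injective_of_surjective_of_injective s a hs fun b =>
        (hW b 0).imp fun w hw => hw.1
    obtain ⟨w, hw, hw'⟩ := hW 0 LinearMap.id
    have hw0 : w = 0 := ha (hw.trans (map_zero a).symm)
    rw [hw0] at hw'
    exact hx (congrArg Subtype.val (LinearMap.congr_fun hw' ⟨x, hxT⟩)).symm
  · push Not at hiso
    obtain ⟨T₁, h₁K, T₂, h₂K, h₁, h₂, hemp⟩ := hiso
    obtain ⟨T₃, h₃K, h₃, h₃₁₂⟩ := Submodule.exists_isAtom_inf_eq_bot hJK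
      (h₁.sup_lt_of_length h₂ h₁K h₂K hK)
    refine ⟨T₁, h₁K, T₂, h₂K, T₃, h₃K, h₁, h₂, h₃, ?_, h₃₁₂, T₃.subtype,
      fun t => h₃K t.2, fun γ hγ hγ' => ?_⟩
    · refine disjoint_iff.1 (h₁.disjoint_of_ne h₂ ?_)
      rintro rfl
      exact hemp.false (LinearEquiv.refl A _)
    · have : IsSimpleModule A T₁ := isSimpleModule_iff_isAtom.2 h₁
      have : IsSimpleModule A T₂ := isSimpleModule_iff_isAtom.2 h₂
      have hr : (γ.restrict hγ) = 0 := (LinearMap.bijective_or_eq_zero _).resolve_left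
        fun hb => hemp.false (LinearEquiv.ofBijective _ hb)
      obtain ⟨x, hx, hx0⟩ := T₁.exists_mem_ne_zero_of_ne_bot h₁.1
      have hk := hzero γ x (h₁K hx) hx0 (congrArg Subtype.val (LinearMap.congr_fun hr ⟨x, hx⟩))
      refine h₃.1 (eq_bot_iff.2 fun t ht => ?_)
      rw [← h₃₁₂]
      have := hγ' ⟨t, ht⟩
      rw [hk t (h₃K ht), zero_sub, neg_mem_iff] at this
      exact ⟨ht, le_sup_right (a := T₁) this⟩

end Atoms

section Gluing

theorem LinearMap.length_ker_add_length_range {A : Type*} [Ring A] {P Q : Type*} [AddCommGroup P]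
    [Module A P] [AddCommGroup Q] [Module A Q] (f : P →ₗ[A] Q) :
    Module.length A (LinearMap.ker f) + Module.length A (LinearMap.range f) =
      Module.length A P := by
  refine (Module.length_eq_add_of_exact (LinearMap.ker f).subtype f.rangeRestrict
    (Submodule.injective_subtype _) f.surjective_rangeRestrict ?_).symm
  rw [LinearMap.exact_iff, LinearMap.ker_rangeRestrict, Submodule.range_subtype]

theorem Submodule.eq_of_le_of_length_le {A : Type*} [Ring A] {P : Type*} [AddCommGroup P]
    [Module A P] [IsArtinian A P] [IsNoetherian A P] {U V : Submodule A P} (hUV : U ≤ V)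
    (h : Module.length A V ≤ Module.length A U) : U = V := by
  by_contra hne
  have h1 := Order.height_add_one_le (lt_of_le_of_ne hUV hne)
  rw [← Module.length_submodule, ← Module.length_submodule] at h1
  exact lt_irrefl _ ((ENat.add_one_le_iff Module.length_ne_top).1 (h1.trans h))

/-- Two copies of a hollow module of Loewy length two which is projective with respect to modules
of Loewy length at most two can be glued to a long indecomposable module. -/
theorem IsHollowModule.not_nonlocalLengthLE {R : Type*} [CommRing R] [IsArtinianRing R]
    {A : Type u} [Ring A] [Algebra R A] [Module.Finite R A] [IsArtinianRing A]
    {N : Type u} [AddCommGroup N] [Module A N] [Module R N] [IsScalarTower R A N]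
    [Module.Finite A N] (hN : IsHollowModule A N)
    (hJ : Ring.jacobson A • Ring.jacobson A • (⊤ : Submodule A N) = ⊥)
    (hlift : ∀ (Z W : Type u) [AddCommGroup Z] [Module A Z] [AddCommGroup W] [Module A W],
      Module.Finite A Z → Ring.jacobson A • Ring.jacobson A • (⊤ : Submodule A Z) = ⊥ →
      ∀ (g : Z →ₗ[A] W) (h : N →ₗ[A] W), Function.Surjective g →
        ∃ h' : N →ₗ[A] Z, g ∘ₗ h' = h)
    (hK : 3 ≤ Module.length A (Ring.jacobson A • ⊤ : Submodule A N)) :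
    ¬ NonlocalLengthLE A 4 := by
  intro hA
  set K : Submodule A N := Ring.jacobson A • ⊤ with hKdef
  obtain ⟨T₁, h₁K, T₂, h₂K, T₃, h₃K, h₁, h₂, h₃, h₁₂, h₃₁₂, f, hfK, hf⟩ :=
    exists_isAtom_forall_endomorphism (R := R) hJ hK (hN.bijective_or_eq_zero hJ)
  have h₃₁ : T₃ ⊓ T₁ = ⊥ := le_bot_iff.1 (h₃₁₂ ▸ inf_le_inf_left T₃ le_sup_left)
  have hKtop : K ≠ ⊤ := Submodule.jacobson_smul_ne_self fun h0 => by
    rw [hKdef, h0, Submodule.smul_bot, Module.length_bot] at hK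
    exact absurd hK (by decide)
  have hntN : Nontrivial N := by
    by_contra hnt
    rw [not_nontrivial_iff_subsingleton] at hnt
    exact hKtop (Subsingleton.elim _ _)
  let φ : (T₁ × T₂ × T₃) →ₗ[A] N × N :=
    (T₁.subtype.coprod (T₃.subtype ∘ₗ LinearMap.snd A T₂ T₃)).prod
      ((T₂.subtype.coprod f) ∘ₗ LinearMap.snd A T₁ (T₂ × T₃))
  have hφ : Function.Injective φ := by
    refine (injective_iff_map_eq_zero φ).2 ?_
    rintro ⟨a, b, c⟩ habc
    have e1 : (a + c : N) = 0 := congrArg Prod.fst habc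
    have e2 : (b + f c : N) = 0 := congrArg Prod.snd habc
    have hc : (c : N) ∈ T₃ ⊓ T₁ :=
      ⟨c.2, by rw [eq_neg_of_add_eq_zero_right e1]; exact neg_mem a.2⟩
    rw [h₃₁, Submodule.mem_bot] at hc
    obtain rfl : c = 0 := Subtype.ext hc
    simp only [map_zero, ZeroMemClass.coe_zero, add_zero, ZeroMemClass.coe_eq_zero] at e1 e2
    rw [e1, e2]; rfl
  set Y := LinearMap.range φ with hY
  have memY : ∀ n m : N, (n, m) ∈ Y ↔ ∃ a ∈ T₁, ∃ b ∈ T₂, ∃ c : T₃, a + c = n ∧ b + f c = m := by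
    intro n m
    constructor
    · rintro ⟨⟨a, b, c⟩, h⟩
      exact ⟨a, a.2, b, b.2, c, congrArg Prod.fst h, congrArg Prod.snd h⟩
    · rintro ⟨a, ha, b, hb, c, h, h'⟩
      exact ⟨(⟨a, ha⟩, ⟨b, hb⟩, c), Prod.ext h h'⟩
  have hYlen : Module.length A Y = 3 := by
    rw [← (LinearEquiv.ofInjective φ hφ).length_eq, Module.length_prod, Module.length_prod,
      Submodule.length_eq_one_of_isAtom h₁, Submodule.length_eq_one_of_isAtom h₂,
      Submodule.length_eq_one_of_isAtom h₃]
    rfl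
  have hYJ : Y ≤ Ring.jacobson A • ⊤ := by
    rintro ⟨n, m⟩ hnm
    obtain ⟨a, ha, b, hb, c, rfl, rfl⟩ := (memY n m).1 hnm
    rw [Ideal.smul_top_prod]
    exact ⟨add_mem (h₁K ha) (h₃K c.2), add_mem (h₂K hb) (hfK c)⟩
  have hnon := not_uniserialAbove_jacobson_smul_top_prod_quotient hYJ
  have hJX := Ideal.smul_top_eq_map_of_surjective (Ring.jacobson A) Y.mkQ Y.mkQ_surjective
  obtain ⟨n, hn⟩ := ENat.ne_top_iff_exists.1 (Module.length_ne_top (R := A) (M := N))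
  obtain ⟨x, hx⟩ := ENat.ne_top_iff_exists.1 (Module.length_ne_top (R := A) (M := (N × N) ⧸ Y))
  have hxn : x + 3 = 2 * n := by
    have := Y.mkQ.length_ker_add_length_range
    rw [Submodule.ker_mkQ, LinearMap.range_eq_top.2 Y.mkQ_surjective, Module.length_top, hYlen,
      Module.length_prod, ← hn, ← hx] at this
    have : 3 + x = n + n := by exact_mod_cast this
    omega
  have hn4 : 4 ≤ n := by
    have := Submodule.length_lt hKtop
    have h4 := hK.trans_lt this
    rw [← hn] at h4
    have : 3 < n := by exact_mod_cast h4
    omega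
  have hJN2 : Ring.jacobson A • Ring.jacobson A • (⊤ : Submodule A (N × N)) = ⊥ :=
    Ideal.smul_smul_top_prod_eq_bot _ hJ hJ
  have key : ∀ X₁ X₂ : Submodule A ((N × N) ⧸ Y), IsCompl X₁ X₂ → X₁ ≠ ⊥ →
      Module.length A X₂ < Module.length A X₁ := by
    intro X₁ X₂ hX hX₁
    by_contra! hlen
    obtain ⟨l, hl⟩ := ENat.ne_top_iff_exists.1 (Module.length_ne_top (R := A) (M := X₁))
    have hln : 2 * l + 3 ≤ 2 * n := by
      have := (Submodule.prodEquivOfIsCompl X₁ X₂ hX).length_eq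
      rw [Module.length_prod, ← hx, ← hl] at this
      rw [← hl] at hlen
      have : (l + l : ℕ∞) ≤ x := this ▸ add_le_add_right hlen _
      have : l + l ≤ x := by exact_mod_cast this
      omega
    let p : ((N × N) ⧸ Y) →ₗ[A] ((N × N) ⧸ Y) := X₁.subtype ∘ₗ X₁.projectionOnto X₂ hX
    have hp : ∀ z ∈ X₁, p z = z := fun z hz => by
      have := Submodule.projectionOnto_apply_left hX ⟨z, hz⟩
      exact congrArg Subtype.val this
    have hpX : ∀ z, p z ∈ X₁ := fun z => (X₁.projectionOnto X₂ hX z).2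
    have hX₁J : ¬ X₁ ≤ Ring.jacobson A • ⊤ := fun hle => by
      have := Submodule.eq_of_le_sup_jacobson_smul (V := X₂) le_top
        (hX.sup_eq_top.ge.trans (sup_le (hle.trans le_sup_right) le_sup_left))
      exact hX₁ (by simpa [this] using hX.inf_eq_bot)
    obtain ⟨h, hhX, hhJ⟩ : ∃ h : N →ₗ[A] (N × N) ⧸ Y, LinearMap.range h ≤ X₁ ∧
        ¬ LinearMap.range h ≤ Ring.jacobson A • ⊤ := by
      by_contra! hcon
      have c1 := hcon (p ∘ₗ Y.mkQ ∘ₗ LinearMap.inl A N N) (by rintro _ ⟨z, rfl⟩; exact hpX _)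
      have c2 := hcon (p ∘ₗ Y.mkQ ∘ₗ LinearMap.inr A N N) (by rintro _ ⟨z, rfl⟩; exact hpX _)
      refine hX₁J fun z hz => ?_
      rw [← hp z hz]
      obtain ⟨⟨u, v⟩, rfl⟩ := Y.mkQ_surjective z
      have := add_mem (c1 ⟨u, rfl⟩) (c2 ⟨v, rfl⟩)
      change p (Y.mkQ (u, 0)) + p (Y.mkQ (0, v)) ∈ _ at this
      rwa [← map_add, ← map_add, Prod.mk_add_mk, add_zero, zero_add] at this
    obtain ⟨θ, hθ⟩ := hlift (N × N) ((N × N) ⧸ Y) inferInstance hJN2 Y.mkQ h Y.mkQ_surjective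
    set α := LinearMap.fst A N N ∘ₗ θ with hα
    set β := LinearMap.snd A N N ∘ₗ θ with hβ
    set Y₁ := LinearMap.ker h with hY₁
    have hY₁len : 2 ≤ Module.length A Y₁ := by
      have e1 := h.length_ker_add_length_range
      have e2 := Module.length_le_of_injective (Submodule.inclusion hhX)
        (Submodule.inclusion_injective hhX)
      obtain ⟨y, hy⟩ := ENat.ne_top_iff_exists.1 (Module.length_ne_top (R := A) (M := Y₁))
      obtain ⟨r, hr⟩ := ENat.ne_top_iff_exists.1
        (Module.length_ne_top (R := A) (M := LinearMap.range h))
      rw [← hn, ← hy, ← hr] at e1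
      rw [← hl, ← hr] at e2
      rw [← hy]
      have e1 : y + r = n := by exact_mod_cast e1
      have e2 : r ≤ l := by exact_mod_cast e2
      have : 2 ≤ y := by omega
      exact_mod_cast this
    have hY₁K : Y₁ ≤ K := (hN.le_or_eq_top Y₁).resolve_right fun htop => hhJ <| by
      rw [LinearMap.ker_eq_top.1 htop, LinearMap.range_zero]
      exact bot_le
    have hθY : ∀ y ∈ Y₁, ∃ a ∈ T₁, ∃ b ∈ T₂, ∃ c : T₃, a + c = α y ∧ b + f c = β y := by
      intro y hy
      refine (memY (α y) (β y)).1 ((Submodule.Quotient.mk_eq_zero Y).1 ?_)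
      rw [hY₁, ← hθ] at hy
      exact hy
    have hαβ : Function.Bijective α ∨ Function.Bijective β := by
      by_contra! hcon
      refine hhJ ?_
      rw [← hθ, LinearMap.range_comp, hJX]
      refine Submodule.map_mono ?_
      rintro _ ⟨z, rfl⟩
      rw [Ideal.smul_top_prod]
      exact ⟨(hN.bijective_or_range_le α).resolve_left hcon.1 ⟨z, rfl⟩,
        (hN.bijective_or_range_le β).resolve_left hcon.2 ⟨z, rfl⟩⟩
    rcases hN.bijective_or_eq_zero hJ α with hαb | hα0
    · have hle : Y₁.map α ≤ T₁ ⊔ T₃ := by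
        rintro _ ⟨y, hy, rfl⟩
        obtain ⟨a, ha, b, hb, c, hac, hbc⟩ := hθY y hy
        exact hac ▸ Submodule.add_mem_sup ha c.2
      have heq : Y₁.map α = T₁ ⊔ T₃ := by
        refine Submodule.eq_of_le_of_length_le hle ?_
        rw [← (Submodule.equivMapOfInjective α hαb.1 Y₁).length_eq]
        refine le_trans ?_ hY₁len
        refine (Submodule.length_sup_le T₁ T₃).trans ?_
        rw [Submodule.length_eq_one_of_isAtom h₁, Submodule.length_eq_one_of_isAtom h₃]
        decide
      let e := LinearEquiv.ofBijective α hαb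
      have he : ∀ y, e.symm (α y) = y := fun y => e.symm_apply_apply y
      refine hf (β ∘ₗ (e.symm : N →ₗ[A] N)) (fun t ht => ?_) (fun t => ?_)
      · obtain ⟨y, hy, rfl⟩ : t ∈ Y₁.map α := heq ▸ le_sup_left (b := T₃) ht
        obtain ⟨a, ha, b, hb, c, hac, hbc⟩ := hθY y hy
        have hc : (c : N) ∈ T₃ ⊓ T₁ :=
          ⟨c.2, by rw [← add_sub_cancel_left a (c : N), hac]; exact sub_mem ht ha⟩
        rw [h₃₁, Submodule.mem_bot] at hc
        obtain rfl : c = 0 := Subtype.ext hc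
        rw [map_zero, add_zero] at hbc
        rw [LinearMap.comp_apply, LinearEquiv.coe_coe, he, ← hbc]
        exact hb
      · obtain ⟨y, hy, hyt⟩ : (t : N) ∈ Y₁.map α := heq ▸ le_sup_right (a := T₁) t.2
        obtain ⟨a, ha, b, hb, c, hac, hbc⟩ := hθY y hy
        have hc : (t - c : N) ∈ T₃ ⊓ T₁ :=
          ⟨sub_mem t.2 c.2, by rw [← hyt, ← hac, add_sub_cancel_right]; exact ha⟩
        rw [h₃₁, Submodule.mem_bot, sub_eq_zero] at hc
        obtain rfl : t = c := Subtype.ext hc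
        rw [LinearMap.comp_apply, LinearEquiv.coe_coe, ← hyt, he, ← hbc, add_sub_cancel_right]
        exact hb
    · have hβb : Function.Bijective β := hαβ.resolve_left fun hb => by
        obtain ⟨k, hk, hk0⟩ := T₁.exists_mem_ne_zero_of_ne_bot h₁.1
        exact hk0 (hb.1 ((hα0 k (h₁K hk)).trans (map_zero α).symm))
      have hle : Y₁.map β ≤ T₂ := by
        rintro _ ⟨y, hy, rfl⟩
        obtain ⟨a, ha, b, hb, c, hac, hbc⟩ := hθY y hy
        rw [hα0 y (hY₁K hy)] at hac
        have hc : (c : N) ∈ T₃ ⊓ T₁ :=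
          ⟨c.2, by rw [eq_neg_of_add_eq_zero_right hac]; exact neg_mem ha⟩
        rw [h₃₁, Submodule.mem_bot] at hc
        obtain rfl : c = 0 := Subtype.ext hc
        rw [map_zero, add_zero] at hbc
        exact hbc ▸ hb
      have := Module.length_le_of_injective (Submodule.inclusion hle)
        (Submodule.inclusion_injective hle)
      rw [← (Submodule.equivMapOfInjective β hβb.1 Y₁).length_eq,
        Submodule.length_eq_one_of_isAtom h₂] at this
      exact absurd (hY₁len.trans this) (by decide)
  have hindec : IsIndecModule A ((N × N) ⧸ Y) := by
    refine ⟨Module.length_pos_iff (R := A) |>.1 ?_, fun X₁ X₂ hX => ?_⟩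
    · rw [← hx]
      have : 0 < x := by omega
      exact_mod_cast this
    · by_contra! hcon
      exact lt_asymm (key X₁ X₂ hX hcon.1) (key X₂ X₁ hX.symm hcon.2)
  have := hA _ inferInstance hindec hnon
  rw [← hx] at this
  have : x ≤ 4 := by exact_mod_cast this
  omega

theorem UniserialAbove.length_jacobson_smul_top_lt {R : Type*} [CommRing R] [IsArtinianRing R]
    {A : Type u} [Ring A] [Algebra R A] [Module.Finite R A] [IsArtinianRing A]
    (hA : NonlocalLengthLE A 4) {M : Type u} [AddCommGroup M] [Module A M] [Module.Finite A M]
    (h : UniserialAbove (Ring.jacobson A • ⊤ : Submodule A M))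
    (hJ : Ring.jacobson A • Ring.jacobson A • (⊤ : Submodule A M) = ⊥) :
    Module.length A (Ring.jacobson A • ⊤ : Submodule A M) < 3 := by
  by_contra! hlen
  have : Nontrivial M := by
    by_contra hnt
    rw [not_nontrivial_iff_subsingleton] at hnt
    rw [Module.length_eq_zero] at hlen
    exact absurd hlen (by decide)
  obtain ⟨I, hI, hIJ, ⟨f, hf⟩, hlift⟩ := h.isHollowModule.exists_cover hJ
  refine hI.not_nonlocalLengthLE (R := R) hIJ hlift (hlen.trans ?_) hA
  rw [Ideal.smul_top_eq_map_of_surjective _ f hf]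
  exact Module.length_le_of_surjective _
    (LinearMap.submoduleMap_surjective f (Ring.jacobson A • ⊤))

end Gluing

section Structure

theorem IsLocalModule.isCoatom_jacobson_smul_top {A : Type*} [Ring A] [IsArtinianRing A]
    {M : Type*} [AddCommGroup M] [Module A M] (h : IsLocalModule A M) :
    IsCoatom (Ring.jacobson A • ⊤ : Submodule A M) := by
  obtain ⟨C, hC, hC'⟩ := h
  have : moduleRad A M = C := le_antisymm (sInf_le hC) (le_sInf fun D hD => (hC' D hD).ge)
  rwa [← moduleRad_eq_jacobson_smul, this]

theorem IsCoatom.uniserialAbove {A : Type*} [Ring A] {M : Type*} [AddCommGroup M] [Module A M]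
    {K : Submodule A M} (hK : IsCoatom K) : UniserialAbove K := by
  intro U V hU hV
  rcases hK.le_iff.1 hU with rfl | rfl
  · exact Or.inr le_top
  · exact Or.inl hV

theorem UniserialAbove.radPow_succ {A : Type u} [Ring A] [IsArtinianRing A]
    (hA : NonlocalLengthLE A 4) {M : Type u} [AddCommGroup M] [Module A M] [Module.Finite A M]
    {a : ℕ} (h : UniserialAbove (radPow A M (a + 2))) : UniserialAbove (radPow A M (a + 3)) := by
  set q := (radPow A M (a + 3)).mkQ with hq
  have hqs : Function.Surjective q := Submodule.mkQ_surjective _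
  have e : ∀ n, (radPow A M (n + 1)).map q = Ring.jacobson A • (radPow A M n).map q := fun n => by
    rw [← Submodule.map_smul'', ← radPow_succ_eq]
  have h0 : (radPow A M (a + 3)).map q = ⊥ := Submodule.mkQ_map_self _
  have key := UniserialAbove.bot_of_nonlocalLengthLE hA (B := (radPow A M (a + 1)).map q)
    (by rw [e]; exact smul_mono_right _ le_top) (by rw [← e, ← e]; exact h0)
    (by rw [← e]; exact h.map q hqs)
  have := key.comap q hqs
  rwa [Submodule.comap_bot, hq, Submodule.ker_mkQ] at this

theorem Submodule.length_add_one_le_of_lt {A : Type*} [Ring A] {M : Type*} [AddCommGroup M]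
    [Module A M] {U V : Submodule A M} (h : U < V) :
    Module.length A U + 1 ≤ Module.length A V := by
  rw [Module.length_submodule, Module.length_submodule]
  exact Order.height_add_one_le h

theorem Submodule.isAtom_of_length_le_one {A : Type*} [Ring A] {M : Type*} [AddCommGroup M]
    [Module A M] {U : Submodule A M} (hU : U ≠ ⊥) (h : Module.length A U ≤ 1) : IsAtom U := by
  rw [← isSimpleModule_iff_isAtom, ← Module.length_eq_one_iff]
  have : Nontrivial U := Submodule.nontrivial_iff_ne_bot.2 hU
  exact le_antisymm h (Order.one_le_iff_pos.2 Module.length_pos)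

theorem IsCoatom.length_add_one {A : Type*} [Ring A] {M : Type*} [AddCommGroup M] [Module A M]
    {K : Submodule A M} (hK : IsCoatom K) : Module.length A K + 1 = Module.length A M := by
  have h := K.mkQ.length_ker_add_length_range
  have : IsSimpleModule A (M ⧸ K) := isSimpleModule_iff_isCoatom.2 hK
  rwa [Submodule.ker_mkQ, LinearMap.range_eq_top.2 K.mkQ_surjective, Module.length_top,
    Module.length_eq_one A (M ⧸ K)] at h

/-- If `rad N` is simple and `N` has length two, then `N` is uniserial with socle `rad N`. -/
theorem isUniserialModule_and_socOf_eq {A : Type*} [Ring A] {M : Type*} [AddCommGroup M]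
    [Module A M] [IsArtinian A M] [IsNoetherian A M] {N : Submodule A M}
    (hN : Module.length A N = 2) (hJN : IsAtom (Ring.jacobson A • N)) :
    IsUniserialModule A N ∧ socOf N = Ring.jacobson A • N := by
  set L := Ring.jacobson A • N with hL
  have hLN : L ≤ N := Submodule.smul_le_right
  have key : ∀ V ≤ N, V ≤ L ∨ V = N := by
    intro V hV
    by_cases h : V ⊔ L = N
    · exact Or.inr (Submodule.eq_of_le_sup_jacobson_smul hV h.ge)
    · left
      by_contra hVL
      have h1 := Submodule.length_add_one_le_of_lt (right_lt_sup.2 hVL)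
      have h2 := Submodule.length_add_one_le_of_lt (lt_of_le_of_ne (sup_le hV hLN) h)
      rw [Submodule.length_eq_one_of_isAtom hJN] at h1
      have := (add_le_add_left h1 1).trans (hN ▸ h2)
      exact absurd this (by decide)
  have key' : ∀ V : Submodule A N, V = ⊥ ∨ V.map N.subtype = L ∨ V = ⊤ := by
    intro V
    rcases key _ (Submodule.map_subtype_le N V) with h | h
    · refine (hJN.le_iff.1 h).imp (fun h0 => ?_) Or.inl
      exact Submodule.map_injective_of_injective N.injective_subtype (by rw [h0, Submodule.map_bot])
    · refine Or.inr (Or.inr (Submodule.map_injective_of_injective N.injective_subtype ?_))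
      rw [h, Submodule.map_top, Submodule.range_subtype]
  have hmap : (Submodule.submoduleOf L N).map N.subtype = L := by
    rw [Submodule.submoduleOf, Submodule.map_comap_subtype, inf_eq_right.2 hLN]
  constructor
  · intro U V
    rcases key' U with rfl | hU | rfl
    · exact Or.inl bot_le
    · rcases key' V with rfl | hV | rfl
      · exact Or.inr bot_le
      · exact Or.inl (Submodule.map_injective_of_injective N.injective_subtype
          (hU.trans hV.symm)).le
      · exact Or.inl le_top
    · exact Or.inr le_top
  · rw [socOf, moduleSoc]
    apply le_antisymm
    · rw [Submodule.map_le_iff_le_comap]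
      refine sSup_le fun T (hT : IsAtom T) => ?_
      rw [← Submodule.map_le_iff_le_comap]
      rcases key' T with rfl | h | rfl
      · exact absurd rfl hT.1
      · exact h.le
      · have := Submodule.length_eq_one_of_isAtom hT
        rw [Module.length_top, hN] at this
        exact absurd this (by decide)
    · rw [← hmap]
      refine Submodule.map_mono (le_sSup ?_)
      have : IsSimpleModule A L := isSimpleModule_iff_isAtom.2 hJN
      exact isSimpleModule_iff_isAtom.1
        (IsSimpleModule.congr (Submodule.submoduleOfEquivOfLe hLN))

end Structure

theorem radical_of_local_three_factor_serial_nonsimple_socle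
    (R : Type*) [CommRing R] [IsArtinianRing R]
    (Λ : Type u) [Ring Λ] [Algebra R Λ] [Module.Finite R Λ]
    (hΛ : IsRightNNakayama Λ 4)
    (M : Type u) [AddCommGroup M] [Module Λᵐᵒᵖ M] [Module.Finite Λᵐᵒᵖ M]
    (hind : IsIndecModule Λᵐᵒᵖ M) (hfs : IsNFactorSerial Λᵐᵒᵖ M 3)
    (hloc : IsLocalModule Λᵐᵒᵖ M) (hncoloc : ¬ IsColocalModule Λᵐᵒᵖ M) :
    moduleLength Λᵐᵒᵖ M = (4 : ℕ) ∧
    ∃ N S1 : Submodule Λᵐᵒᵖ M,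
      IsUniserialModule Λᵐᵒᵖ ↑N ∧ moduleLength Λᵐᵒᵖ ↑N = (2 : ℕ) ∧
      IsAtom S1 ∧ Disjoint N S1 ∧ radPow Λᵐᵒᵖ M 1 = N ⊔ S1 ∧
      IsAtom (socOf N) ∧ socOf N ≠ S1 ∧
      moduleSoc Λᵐᵒᵖ M = S1 ⊔ socOf N := by
  have : IsArtinianRing Λᵐᵒᵖ := IsArtinianRing.of_finite R Λᵐᵒᵖ
  have hA := hΛ.nonlocalLengthLE
  have hK := hloc.isCoatom_jacobson_smul_top
  obtain ⟨-, -, l, hl, h3l, huni, hnuni⟩ := hfs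
  rw [← uniserialAbove_iff] at huni hnuni
  have hl4 : l = 4 := by
    obtain ⟨b, rfl⟩ := Nat.exists_eq_add_of_le h3l
    rw [Nat.add_sub_cancel_left] at huni hnuni
    match b with
    | 0 =>
      rw [zero_add, radPow_succ_eq] at hnuni
      exact absurd hK.uniserialAbove hnuni
    | 1 => rfl
    | b + 2 => exact absurd (huni.radPow_succ hA) hnuni
  subst hl4
  have e1 : radPow Λᵐᵒᵖ M 1 = Ring.jacobson Λᵐᵒᵖ • ⊤ := radPow_succ_eq 0
  have e2 : radPow Λᵐᵒᵖ M 2 = Ring.jacobson Λᵐᵒᵖ • Ring.jacobson Λᵐᵒᵖ • ⊤ := by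
    rw [radPow_succ_eq, e1]
  change ¬ UniserialAbove (radPow Λᵐᵒᵖ M 2) at hnuni
  rw [e2] at hnuni
  refine ⟨hl, ?_⟩
  set K : Submodule Λᵐᵒᵖ M := Ring.jacobson Λᵐᵒᵖ • ⊤ with hKdef
  have hMlen : Module.length Λᵐᵒᵖ M = 4 := by
    rw [moduleLength, ← Module.coe_length] at hl
    exact WithBot.coe_injective hl
  have hKlen : Module.length Λᵐᵒᵖ K = 3 := by
    have := hK.length_add_one
    rw [hMlen] at this
    exact (ENat.add_left_injective_of_ne_top (n := 1) (by decide))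
      (this.trans (by rfl : (4 : ℕ∞) = 3 + 1))
  have hL0 : Ring.jacobson Λᵐᵒᵖ • K ≠ ⊥ := fun h0 =>
    (hK.uniserialAbove.length_jacobson_smul_top_lt (R := R) hA h0).ne hKlen
  set L := Ring.jacobson Λᵐᵒᵖ • K with hLdef
  have hLK : L ≤ K := Submodule.smul_le_right
  have hleK : ∀ V : Submodule Λᵐᵒᵖ M, V ≤ K ∨ V = ⊤ := fun V =>
    (hK.uniserialAbove.le_or_le_sup V).imp_right (Submodule.eq_of_le_sup_jacobson_smul le_top)
  have hatomK : ∀ V : Submodule Λᵐᵒᵖ M, IsAtom V → V ≤ K := fun V hV =>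
    (hleK V).resolve_right fun h => by
      have := Submodule.length_eq_one_of_isAtom (h ▸ hV)
      rw [Module.length_top, hMlen] at this
      exact absurd this (by decide)
  have hL : IsAtom L := by
    refine Submodule.isAtom_of_length_le_one hL0 ?_
    rw [UniserialAbove] at hnuni
    push Not at hnuni
    obtain ⟨U, V, hU, hV, hUV, hVU⟩ := hnuni
    have hUK : U < K := by
      refine lt_of_le_of_ne ((hleK U).resolve_right fun h => hVU (h ▸ le_top)) ?_
      rintro rfl
      exact hVU ((hleK V).resolve_right fun h => hUV (h ▸ le_top))
    have hLU : L < U := lt_of_le_of_ne hU fun h => hUV (h ▸ hV)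
    have h1 := Submodule.length_add_one_le_of_lt hLU
    have h2 := Submodule.length_add_one_le_of_lt hUK
    have h3 := (add_le_add_left h1 1).trans h2
    rw [hKlen, add_assoc, (by rfl : (3 : ℕ∞) = 1 + (1 + 1))] at h3
    exact (ENat.add_le_add_iff_right (by decide)).1 h3
  obtain ⟨S, hS, hSL⟩ : ∃ S : Submodule Λᵐᵒᵖ M, IsAtom S ∧ S ≠ L := by
    by_contra! hcon
    have : {N : Submodule Λᵐᵒᵖ M | IsAtom N} = {L} :=
      Set.ext fun V => ⟨hcon V, fun h => h ▸ hL⟩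
    exact hncoloc (by rwa [IsColocalModule, moduleSoc, this, sSup_singleton])
  have hSLdisj : Disjoint S L := hS.disjoint_of_ne hL hSL
  obtain ⟨N, hNK, hLN, hN1, hN2⟩ := Submodule.exists_compl_above_jacobson_smul (B := K)
    (V := S ⊔ L) le_sup_right (sup_le (hatomK S hS) hLK)
  have hNS : N ⊔ S = K := by
    rw [← hN2, sup_comm S, ← sup_assoc, sup_eq_left.2 hLN]
  have hNSdisj : Disjoint N S := disjoint_iff_inf_le.2 <|
    (le_inf inf_le_right ((inf_le_inf_left N le_sup_left).trans hN1.le)).trans hSLdisj.le_bot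
  have hNlen : Module.length Λᵐᵒᵖ N = 2 := by
    apply le_antisymm
    · have hlt : N < K := lt_of_le_of_ne hNK fun h =>
        hS.1 (hNSdisj.symm.eq_bot_of_le (h ▸ hatomK S hS))
      have h1 := Submodule.length_add_one_le_of_lt hlt
      rw [hKlen, (by rfl : (3 : ℕ∞) = 2 + 1)] at h1
      exact (ENat.add_le_add_iff_right (by decide)).1 h1
    · have h1 := Submodule.length_sup_le N S
      rw [hNS, hKlen, Submodule.length_eq_one_of_isAtom hS, (by rfl : (3 : ℕ∞) = 2 + 1)] at h1
      exact (ENat.add_le_add_iff_right (by decide)).1 h1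
  have hJN : Ring.jacobson Λᵐᵒᵖ • N = L := by
    rw [hLdef, ← hNS, Submodule.smul_sup, Submodule.jacobson_smul_eq_bot_of_isAtom hS, sup_bot_eq]
  obtain ⟨hNuni, hNsoc⟩ := isUniserialModule_and_socOf_eq hNlen (hJN ▸ hL)
  rw [hJN] at hNsoc
  refine ⟨N, S, hNuni, ?_, hS, hNSdisj, e1.trans hNS.symm, hNsoc ▸ hL, hNsoc ▸ hSL.symm, ?_⟩
  · rw [moduleLength, ← Module.coe_length, hNlen]
    rfl
  · rw [hNsoc, moduleSoc]
    refine le_antisymm (sSup_le fun V (hV : IsAtom V) => ?_) (sup_le (le_sSup hS) (le_sSup hL))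
    by_contra hVSL
    have h1 := Submodule.length_add_one_le_of_lt (right_lt_sup.2 fun h : S ≤ L =>
      hS.1 (hSLdisj.eq_bot_of_le h))
    have h2 := Submodule.length_add_one_le_of_lt (right_lt_sup.2 hVSL)
    rw [Submodule.length_eq_one_of_isAtom hL] at h1
    have heq : V ⊔ (S ⊔ L) = K := by
      refine Submodule.eq_of_le_of_length_le
        (sup_le (hatomK V hV) (sup_le (hatomK S hS) hLK)) ?_
      rw [hKlen]
      exact (add_le_add_left h1 1).trans h2
    refine hL0 ?_
    rw [hLdef, ← heq, Submodule.smul_sup, Submodule.smul_sup,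
      Submodule.jacobson_smul_eq_bot_of_isAtom hV, Submodule.jacobson_smul_eq_bot_of_isAtom hS,
      Submodule.jacobson_smul_eq_bot_of_isAtom hL, sup_bot_eq, sup_bot_eq]
end

section
/- Let Λ be a right 4-Nakayama artin algebra and let M be a finitely generated indecomposable 2-factor serial local right Λ-module. Then l(M) = 3 and rad(M) = soc(M) = S1 ⊕ S2 is a direct sum of two simple submodules of M. -/
/-! Basic definitions for (right) modules over a ring: radical, socle, length,
uniserial, local, indecomposable, `n`-factor serial, right `n`-Nakayama algebras,
Nakayama algebras and almost split sequences. -/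

universe u v w

section Radical

variable {A : Type*} [Ring A] {M : Type*} [AddCommGroup M] [Module A M]

theorem radOf_le (N : Submodule A M) : radOf N ≤ N :=
  Submodule.map_subtype_le _ _

theorem radOf_le_of_covBy {C N : Submodule A M} (h : C ⋖ N) : radOf N ≤ C := by
  have hC : IsCoatom (C.comap N.subtype) := by
    rw [covBy_iff_coatom_Iic h.le, ← OrderIso.isCoatom_iff (Submodule.mapIic N).symm] at h
    exact h
  rintro _ ⟨y, hy, rfl⟩
  exact (sInf_le hC : moduleRad A N ≤ _) hy

theorem le_radOf {P N : Submodule A M} (hP : P ≤ N) (h : ∀ C, C ⋖ N → P ≤ C) :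
    P ≤ radOf N := by
  have hmap : P.comap N.subtype ≤ moduleRad A N := by
    refine le_sInf fun D hD => ?_
    have hcov : D.map N.subtype ⋖ N := by
      rw [covBy_iff_coatom_Iic (Submodule.map_subtype_le _ _)]
      exact (OrderIso.isCoatom_iff (Submodule.mapIic N) D).2 hD
    refine (Submodule.comap_mono (h _ hcov)).trans ?_
    rw [Submodule.comap_map_eq_of_injective N.injective_subtype]
  intro x hx
  exact ⟨⟨x, hP hx⟩, hmap hx, rfl⟩

theorem radOf_lt [IsNoetherian A M] {N : Submodule A M} (hN : N ≠ ⊥) : radOf N < N := by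
  obtain ⟨C, -, hC⟩ := exists_le_covBy_of_lt (bot_lt_iff_ne_bot.2 hN)
  exact (radOf_le_of_covBy hC).trans_lt hC.lt

theorem radPow_succ_le (n : ℕ) : radPow A M (n + 1) ≤ radPow A M n :=
  radOf_le _

theorem radPow_antitone : Antitone (radPow A M) :=
  antitone_nat_of_succ_le radPow_succ_le

theorem radPow_le_of_isCoatom {C : Submodule A M} (hC : IsCoatom C) {n : ℕ} (hn : 1 ≤ n) :
    radPow A M n ≤ C :=
  (radPow_antitone hn).trans (radOf_le_of_covBy (covBy_top_iff.2 hC))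

theorem isUniserialModule_quotient_iff (r : Submodule A M) :
    IsUniserialModule A (M ⧸ r) ↔
      ∀ P Q : Submodule A M, r ≤ P → r ≤ Q → P ≤ Q ∨ Q ≤ P := by
  let e := Submodule.comapMkQRelIso r
  constructor
  · intro h P Q hP hQ
    have := h (e.symm ⟨P, hP⟩) (e.symm ⟨Q, hQ⟩)
    rwa [e.symm.le_iff_le, e.symm.le_iff_le] at this
  · intro h P Q
    have := h (e P) (e Q) (e P).2 (e Q).2
    rwa [Subtype.coe_le_coe, Subtype.coe_le_coe, e.le_iff_le, e.le_iff_le] at this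

/-- If the submodules above the `k`-th radical form a chain, then every submodule is comparable
with that radical. -/
theorem le_radPow_or_radPow_le [IsNoetherian A M] {k : ℕ}
    (hk : IsUniserialModule A (M ⧸ radPow A M k)) (P : Submodule A M) :
    P ≤ radPow A M k ∨ radPow A M k ≤ P := by
  rw [isUniserialModule_quotient_iff] at hk
  suffices H : ∀ i ≤ k, P ≤ radPow A M i ∨ radPow A M i ≤ P from H k le_rfl
  intro i
  induction i with
  | zero => exact fun _ => Or.inl le_top
  | succ i ih =>
    intro hik
    rcases ih (by omega) with h | h
    · rcases h.eq_or_lt with h | h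
      · exact Or.inr (h ▸ radPow_succ_le i)
      · left
        obtain ⟨C, hPC, hC⟩ := exists_le_covBy_of_lt h
        refine hPC.trans (le_radOf hC.le fun D hD => ?_)
        have hle : ∀ E, E ⋖ radPow A M i → radPow A M k ≤ E := fun E hE =>
          (radPow_antitone hik).trans (radOf_le_of_covBy hE)
        rcases hk C D (hle C hC) (hle D hD) with h' | h'
        · exact h'
        · rcases hD.eq_or_eq h' hC.le with h'' | h''
          · exact h''.le
          · exact absurd h'' hC.ne
    · exact Or.inr ((radPow_succ_le i).trans h)

theorem isNoetherian_and_isArtinian_of_moduleLength {l : ℕ} (h : moduleLength A M = l) :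
    IsNoetherian A M ∧ IsArtinian A M := by
  rw [← isFiniteLength_iff_isNoetherian_isArtinian, ← Module.length_ne_top_iff]
  intro htop
  rw [moduleLength, ← Module.coe_length, htop] at h
  exact absurd (WithBot.coe_injective h) (ENat.top_ne_natCast l)

/-- In a `2`-factor serial module of length `k + 2`, the `k`-th radical is the sum of two distinct
simple submodules and is comparable with every submodule. -/
theorem IsNFactorSerial.exists_radPow_eq_sup (h : IsNFactorSerial A M 2) :
    ∃ (k : ℕ) (S1 S2 : Submodule A M), moduleLength A M = (k + 2 : ℕ) ∧
      IsAtom S1 ∧ IsAtom S2 ∧ S1 ≠ S2 ∧ S1 ⋖ radPow A M k ∧ S2 ⋖ radPow A M k ∧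
      radPow A M k = S1 ⊔ S2 ∧
      (∀ P : Submodule A M, P ≤ radPow A M k ∨ radPow A M k ≤ P) ∧
      (∀ i ≤ k, radPow A M (i + 1) < radPow A M i) := by
  obtain ⟨-, hM, l, hl, hl2, hu, hnu⟩ := h
  obtain ⟨k, rfl⟩ := Nat.exists_eq_add_of_le' hl2
  rw [Nat.add_sub_cancel] at hu hnu
  obtain ⟨hN, -⟩ := isNoetherian_and_isArtinian_of_moduleLength hl
  have hcmp := le_radPow_or_radPow_le hu
  rw [isUniserialModule_quotient_iff] at hu hnu
  have hbot : ∀ i ≤ k, radPow A M i ≠ ⊥ := fun i hi h0 =>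
    hM fun P Q => by
      have h0k : radPow A M k = ⊥ := le_bot_iff.1 (h0 ▸ radPow_antitone hi)
      exact hu P Q (h0k ▸ bot_le) (h0k ▸ bot_le)
  have hlt : ∀ i ≤ k, radPow A M (i + 1) < radPow A M i := fun i hi => radOf_lt (hbot i hi)
  have hco : ∀ i ≤ k, (i : ℕ∞) ≤ Order.coheight (radPow A M i) := by
    intro i
    induction i with
    | zero => simp
    | succ i ih =>
      intro hi
      calc ((i + 1 : ℕ) : ℕ∞) = (i : ℕ∞) + 1 := by push_cast; rfl
        _ ≤ Order.coheight (radPow A M i) + 1 := by gcongr; exact ih (by omega)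
        _ ≤ _ := Order.coheight_add_one_le (hlt i (by omega))
  have hshort : ∀ C D : Submodule A M, D < C → C < radPow A M k → D = ⊥ := by
    intro C D hDC hC
    by_contra hD
    have h3 : ((k + 3 : ℕ) : ℕ∞) ≤ Order.coheight (⊥ : Submodule A M) :=
      calc ((k + 3 : ℕ) : ℕ∞) = (k : ℕ∞) + 1 + 1 + 1 := by push_cast; ring
        _ ≤ Order.coheight (radPow A M k) + 1 + 1 + 1 := by gcongr; exact hco k le_rfl
        _ ≤ Order.coheight C + 1 + 1 := by gcongr; exact Order.coheight_add_one_le hC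
        _ ≤ Order.coheight D + 1 := by gcongr; exact Order.coheight_add_one_le hDC
        _ ≤ _ := Order.coheight_add_one_le (bot_lt_iff_ne_bot.2 hD)
    have h4 := Order.coheight_le_krullDim (⊥ : Submodule A M)
    rw [show Order.krullDim (Submodule A M) = ((k + 2 : ℕ) : WithBot ℕ∞) from hl] at h4
    have h5 : ((k + 3 : ℕ) : ℕ∞) ≤ ((k + 2 : ℕ) : ℕ∞) := h3.trans (WithBot.coe_le_coe.1 h4)
    have := Nat.cast_le.1 h5
    omega
  have hncov : ¬ radPow A M (k + 1) ⋖ radPow A M k := by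
    refine fun hcov => hnu fun P Q hP hQ => ?_
    rcases hcmp P with h1 | h1 <;> rcases hcmp Q with h2 | h2
    · rcases hcov.eq_or_eq hP h1 with h | h
      · exact Or.inl (h ▸ hQ)
      · exact Or.inr (h ▸ h2)
    · exact Or.inl (h1.trans h2)
    · exact Or.inr (h2.trans h1)
    · exact hu P Q h1 h2
  obtain ⟨C, hC1, hC⟩ := exists_le_covBy_of_lt (hlt k le_rfl)
  have hC1' : radPow A M (k + 1) < C := hC1.lt_of_ne fun h => hncov (h ▸ hC)
  have hrad : radPow A M (k + 1) = ⊥ := hshort _ _ hC1' hC.lt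
  rw [hrad] at hncov hC1'
  obtain ⟨D, hD, hCD⟩ : ∃ D, D ⋖ radPow A M k ∧ ¬ C ≤ D := by
    by_contra! hcon
    have h1 : C ≤ radPow A M (k + 1) := le_radOf hC.le hcon
    rw [hrad] at h1
    exact (hC1'.trans_le h1).false
  have hD0 : D ≠ ⊥ := fun h => hncov (h ▸ hD)
  have hatom : ∀ E, E ⋖ radPow A M k → E ≠ ⊥ → IsAtom E := fun E hE h0 =>
    ⟨h0, fun F hF => hshort E F hF hE.lt⟩
  have hsup : radPow A M k = C ⊔ D := by
    refine le_antisymm ?_ (sup_le hC.le hD.le)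
    rcases hC.eq_or_eq le_sup_left (sup_le hC.le hD.le) with h | h
    · have hDC : D ≤ C := h ▸ le_sup_right
      rcases hD.eq_or_eq hDC hC.le with h' | h'
      · exact absurd h'.le hCD
      · exact absurd h' hC.ne
    · exact h.ge
  exact ⟨k, C, D, hl, hatom C hC hC1'.ne', hatom D hD hD0, fun h => hCD h.le, hC, hD, hsup,
    hcmp, hlt⟩

end Radical

section Glue

variable {A : Type*} [Ring A] {M X : Type*} [AddCommGroup M] [Module A M]
  [AddCommGroup X] [Module A X]

/-- The configuration used to build large indecomposable modules: a module `M` with a submodule `r`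
that is the sum of two independent nonzero submodules `S1`, `S2`, and the module `X` obtained by
gluing `M` and `L / S1` along `S2`, where `L` covers `r`. -/
structure IsGluing (r S1 S2 L : Submodule A M) (i : M →ₗ[A] X) (j : L →ₗ[A] X) : Prop where
  cmp : ∀ P : Submodule A M, P ≤ r ∨ r ≤ P
  sup_eq : r = S1 ⊔ S2
  disj : S1 ⊓ S2 = ⊥
  left_ne : S1 ≠ ⊥
  right_ne : S2 ≠ ⊥
  covBy : r ⋖ L
  inj : Function.Injective i
  glue : ∀ (x : M) (y : L), i x = j y ↔ x ∈ S2 ∧ x - y ∈ S1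
  span : LinearMap.range i ⊔ LinearMap.range j = ⊤

namespace IsGluing

variable {r S1 S2 L : Submodule A M} {i : M →ₗ[A] X} {j : L →ₗ[A] X}
  (h : IsGluing r S1 S2 L i j)

include h

theorem ne_bot : r ≠ ⊥ := fun h0 =>
  h.left_ne (le_bot_iff.1 (h0 ▸ h.sup_eq ▸ le_sup_left))

theorem mem_range_iff (y : L) : j y ∈ LinearMap.range i ↔ (y : M) ∈ r := by
  constructor
  · rintro ⟨x, hx⟩
    obtain ⟨h1, h2⟩ := (h.glue x y).1 hx
    rw [h.sup_eq]
    have := Submodule.sub_mem (S1 ⊔ S2) (Submodule.mem_sup_right h1) (Submodule.mem_sup_left h2)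
    simpa using this
  · intro hy
    rw [h.sup_eq] at hy
    obtain ⟨a, ha, b, hb, hab⟩ := Submodule.mem_sup.1 hy
    refine ⟨b, (h.glue b y).2 ⟨hb, ?_⟩⟩
    rw [← hab]
    simpa using ha

theorem exists_add (z : X) : ∃ (x : M) (y : L), i x + j y = z := by
  have hz : z ∈ LinearMap.range i ⊔ LinearMap.range j := h.span ▸ Submodule.mem_top
  obtain ⟨_, ⟨x, rfl⟩, _, ⟨y, rfl⟩, hxy⟩ := Submodule.mem_sup.1 hz
  exact ⟨x, y, hxy⟩

theorem isCoatom_range : IsCoatom (LinearMap.range i) := by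
  constructor
  · intro htop
    refine h.covBy.lt.not_ge fun y hy => ?_
    exact (h.mem_range_iff ⟨y, hy⟩).1 (htop ▸ Submodule.mem_top)
  · intro Z hZ
    let W : Submodule A M := (Z.comap j).map L.subtype
    have hrW : r ≤ W := fun y hy =>
      ⟨⟨y, h.covBy.le hy⟩, hZ.le ((h.mem_range_iff ⟨y, _⟩).2 hy), rfl⟩
    rcases h.covBy.eq_or_eq hrW (Submodule.map_subtype_le _ _) with hW | hW
    · refine absurd hZ.le fun _ => hZ.not_ge fun z hz => ?_
      obtain ⟨x, y, rfl⟩ := h.exists_add z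
      have hy : j y ∈ Z := (Submodule.add_mem_iff_right _ (hZ.le ⟨x, rfl⟩)).1 hz
      have hyr : (y : M) ∈ r := hW ▸ ⟨y, hy, rfl⟩
      exact Submodule.add_mem _ ⟨x, rfl⟩ ((h.mem_range_iff y).2 hyr)
    · rw [eq_top_iff, ← h.span]
      refine sup_le hZ.le ?_
      rintro _ ⟨y, rfl⟩
      have hy : (y : M) ∈ W := hW.ge y.2
      obtain ⟨y', hy', hyy⟩ := hy
      rwa [Subtype.ext hyy] at hy'

section Coatoms

variable {N : Submodule A M} (hrN : r < N)

include hrN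

theorem mem_of_map_mem {x : M} (hx : i x ∈ N.map i ⊔ LinearMap.range j) : x ∈ N := by
  obtain ⟨_, ⟨n, hn, rfl⟩, _, ⟨y, rfl⟩, hxy⟩ := Submodule.mem_sup.1 hx
  have h1 : i (x - n) = j y := by rw [map_sub, ← hxy]; abel
  have h2 : x - n ∈ N :=
    hrN.le (h.sup_eq ▸ Submodule.mem_sup_right ((h.glue _ y).1 h1).1)
  exact (Submodule.sub_mem_iff_left _ hn).1 h2

variable (hN : IsCoatom N)

include hN

theorem isCoatom_sup : IsCoatom (N.map i ⊔ LinearMap.range j) := by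
  constructor
  · intro htop
    exact hN.1 (eq_top_iff.2 fun x _ => h.mem_of_map_mem hrN (htop ▸ Submodule.mem_top))
  · intro Z hZ
    have hNZ : N ≤ Z.comap i := Submodule.map_le_iff_le_comap.1 (le_sup_left.trans hZ.le)
    have hjZ : LinearMap.range j ≤ Z := le_sup_right.trans hZ.le
    rcases hNZ.eq_or_lt with hE | hlt
    · refine absurd hZ.le fun _ => hZ.not_ge fun z hz => ?_
      obtain ⟨x, y, rfl⟩ := h.exists_add z
      have hx : x ∈ Z.comap i := (Submodule.add_mem_iff_left _ (hjZ ⟨y, rfl⟩)).1 hz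
      exact Submodule.add_mem_sup (Submodule.mem_map_of_mem (hE ▸ hx)) ⟨y, rfl⟩
    · have := hN.2 _ hlt
      rw [eq_top_iff, ← h.span]
      refine sup_le ?_ hjZ
      rintro _ ⟨x, rfl⟩
      have hx : x ∈ Z.comap i := this ▸ Submodule.mem_top
      exact hx

theorem exists_isCoatom_ne : ∃ C D : Submodule A X, IsCoatom C ∧ IsCoatom D ∧ C ≠ D := by
  refine ⟨_, _, h.isCoatom_range, h.isCoatom_sup hrN hN, fun hE => hN.1 (eq_top_iff.2 ?_)⟩
  exact fun x _ => h.mem_of_map_mem hrN (hE ▸ ⟨x, rfl⟩)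

theorem jacobson_eq (hNJ : N ≤ Module.jacobson A M) : Module.jacobson A X = N.map i := by
  apply le_antisymm
  · intro z hz
    obtain ⟨x, rfl⟩ := (sInf_le h.isCoatom_range : Module.jacobson A X ≤ _) hz
    exact ⟨x, h.mem_of_map_mem hrN
      ((sInf_le (h.isCoatom_sup hrN hN) : Module.jacobson A X ≤ _) hz), rfl⟩
  · exact (Submodule.map_mono hNJ).trans (Module.map_jacobson_le i)

end Coatoms

/-- No map `L → M` restricts to the identity on `S2` and vanishes on `S1`. -/
theorem not_exists_extension (g : L →ₗ[A] M) (h1 : ∀ y : L, (y : M) ∈ S1 → g y = 0)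
    (h2 : ∀ y : L, (y : M) ∈ S2 → g y = y) : False := by
  have hdisj : ∀ x, x ∈ S1 → x ∈ S2 → x = 0 := fun x hx1 hx2 => by
    have : x ∈ S1 ⊓ S2 := ⟨hx1, hx2⟩
    rwa [h.disj, Submodule.mem_bot] at this
  have hS1 : S1 ≤ r := h.sup_eq ▸ le_sup_left
  have hS2 : S2 ≤ r := h.sup_eq ▸ le_sup_right
  have hQ : (S1.comap g).map L.subtype ≤ r := by
    refine (h.cmp _).resolve_right fun hle => h.right_ne (eq_bot_iff.2 fun s hs => ?_)
    obtain ⟨y, hy, rfl⟩ := hle (hS2 hs)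
    have hy' : g y ∈ S1 := hy
    rw [h2 y hs] at hy'
    exact hdisj _ hy' hs
  have hker : ∀ y : L, g y ∈ S1 → (y : M) ∈ S1 := by
    intro y hy
    have hyr : (y : M) ∈ r := hQ ⟨y, hy, rfl⟩
    rw [h.sup_eq] at hyr
    obtain ⟨a, ha, b, hb, hab⟩ := Submodule.mem_sup.1 hyr
    have haL : a ∈ L := h.covBy.le (hS1 ha)
    have hbL : b ∈ L := h.covBy.le (hS2 hb)
    have hy' : y = ⟨a, haL⟩ + ⟨b, hbL⟩ := Subtype.ext hab.symm
    rw [hy', map_add, h1 ⟨a, haL⟩ ha, h2 ⟨b, hbL⟩ hb, zero_add] at hy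
    have hb0 : b = 0 := hdisj b hy hb
    rw [← hab, hb0, add_zero]
    exact ha
  have hP : LinearMap.range g ≤ r := by
    refine (h.cmp _).resolve_right fun hle => h.left_ne (eq_bot_iff.2 fun s hs => ?_)
    obtain ⟨y, rfl⟩ := hle (hS1 hs)
    rw [Submodule.mem_bot]
    exact h1 y (hker y hs)
  refine h.covBy.lt.not_ge fun y hy => ?_
  have hgy : g ⟨y, hy⟩ ∈ S1 ⊔ S2 := h.sup_eq ▸ hP ⟨_, rfl⟩
  obtain ⟨a, ha, b, hb, hab⟩ := Submodule.mem_sup.1 hgy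
  have hbL : b ∈ L := h.covBy.le (hS2 hb)
  have hmem : g (⟨y, hy⟩ - ⟨b, hbL⟩) ∈ S1 := by
    rw [map_sub, h2 ⟨b, hbL⟩ hb, ← hab]
    simpa using ha
  have hyb : y - b ∈ r := hS1 (hker _ hmem)
  exact (Submodule.sub_mem_iff_left _ (hS2 hb)).1 hyb

theorem eq_bot_of_comap_eq_bot {B : Submodule A X} (hB : B.comap i = ⊥) : B = ⊥ := by
  by_contra hB0
  have hinf : LinearMap.range i ⊓ B = ⊥ := by
    rw [eq_bot_iff]
    rintro _ ⟨⟨x, rfl⟩, hx⟩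
    have hx' : x ∈ B.comap i := hx
    rw [hB, Submodule.mem_bot] at hx'
    simp [hx']
  have hsup : LinearMap.range i ⊔ B = ⊤ := by
    refine h.isCoatom_range.2 _ (le_sup_left.lt_of_ne fun hE => hB0 ?_)
    rw [← hinf, eq_comm, inf_eq_right, hE]
    exact le_sup_right
  have hc : IsCompl (LinearMap.range i) B := ⟨disjoint_iff.2 hinf, codisjoint_iff.2 hsup⟩
  let p := LinearMap.linearProjOfIsCompl B i h.inj hc
  have hp : ∀ x, p (i x) = x := LinearMap.linearProjOfIsCompl_apply_left B i h.inj hc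
  refine h.not_exists_extension (p ∘ₗ j) (fun y hy => ?_) fun y hy => ?_
  · have : i 0 = j y := (h.glue 0 y).2 ⟨zero_mem _, by simpa using hy⟩
    rw [LinearMap.comp_apply, ← this, hp]
  · have : i y = j y := (h.glue y y).2 ⟨hy, by simp⟩
    rw [LinearMap.comp_apply, ← this, hp]

theorem eq_bot_of_inf_eq_bot {P Q : Submodule A M} (hPQ : P ⊓ Q = ⊥) (hP : r ≤ P) : Q = ⊥ := by
  rcases h.cmp Q with hQ | hQ
  · rwa [inf_eq_right.2 (hQ.trans hP)] at hPQ
  · exact absurd (le_bot_iff.1 (hPQ ▸ le_inf hP hQ)) h.ne_bot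

theorem isIndecModule (hN : IsCoatom N) (hrN : r < N) (hNJ : N ≤ Module.jacobson A M) :
    IsIndecModule A X := by
  constructor
  · by_contra hX
    rw [not_nontrivial_iff_subsingleton] at hX
    exact h.isCoatom_range.1 (Subsingleton.elim _ _)
  intro P Q hPQ
  have hJ := h.jacobson_eq hrN hN hNJ
  have hdisj : P.comap i ⊓ Q.comap i = ⊥ := by
    rw [← Submodule.comap_inf, hPQ.inf_eq_bot, Submodule.comap_bot, LinearMap.ker_eq_bot]
    exact h.inj
  have hle : N ≤ P.comap i ⊔ Q.comap i := by
    intro n hn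
    have hiJ : i n ∈ Module.jacobson A X := hJ ▸ Submodule.mem_map_of_mem hn
    let e : X →ₗ[A] X := P.subtype ∘ₗ P.projectionOnto Q hPQ
    have heJ : e (i n) ∈ N.map i := hJ ▸ Module.le_comap_jacobson e hiJ
    obtain ⟨a, -, hae⟩ := heJ
    have haP : i a ∈ P := hae ▸ (P.projectionOnto Q hPQ (i n)).2
    have hQ : i (n - a) ∈ Q := by
      rw [map_sub, hae, ← Submodule.ker_projectionOnto hPQ, LinearMap.mem_ker, map_sub,
        LinearMap.comp_apply, Submodule.subtype_apply, Submodule.projectionOnto_apply_left,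
        sub_self]
    have := Submodule.add_mem_sup (S := P.comap i) (T := Q.comap i) (s := a) (t := n - a) haP hQ
    simpa using this
  rcases h.cmp (P.comap i) with h1 | h1
  · rcases h.cmp (Q.comap i) with h2 | h2
    · exact absurd (hle.trans (sup_le h1 h2)) hrN.not_ge
    · exact Or.inl (h.eq_bot_of_comap_eq_bot
        (h.eq_bot_of_inf_eq_bot (by rwa [inf_comm]) h2))
  · exact Or.inr (h.eq_bot_of_comap_eq_bot (h.eq_bot_of_inf_eq_bot hdisj h1))

end IsGluing

theorem exists_isGluing {r S1 S2 L : Submodule A M} (cmp : ∀ P : Submodule A M, P ≤ r ∨ r ≤ P)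
    (sup_eq : r = S1 ⊔ S2) (disj : S1 ⊓ S2 = ⊥) (h1 : S1 ≠ ⊥) (h2 : S2 ≠ ⊥) (hL : r ⋖ L) :
    ∃ (K : Submodule A (M × L)) (i : M →ₗ[A] (M × L) ⧸ K) (j : L →ₗ[A] (M × L) ⧸ K),
      IsGluing r S1 S2 L i j := by
  let K : Submodule A (M × L) :=
    S2.comap (LinearMap.fst A M L) ⊓
      S1.comap (LinearMap.fst A M L + L.subtype ∘ₗ LinearMap.snd A M L)
  have hglue : ∀ (x : M) (y : L), (K.mkQ ∘ₗ LinearMap.inl A M L) x =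
      (K.mkQ ∘ₗ LinearMap.inr A M L) y ↔ x ∈ S2 ∧ x - y ∈ S1 := by
    intro x y
    rw [LinearMap.comp_apply, LinearMap.comp_apply, Submodule.mkQ_apply, Submodule.mkQ_apply,
      Submodule.Quotient.eq]
    simp [K, sub_eq_add_neg]
  refine ⟨K, K.mkQ ∘ₗ LinearMap.inl A M L, K.mkQ ∘ₗ LinearMap.inr A M L, cmp, sup_eq, disj, h1,
    h2, hL, ?_, hglue, ?_⟩
  · rw [← LinearMap.ker_eq_bot, LinearMap.ker_eq_bot']
    intro x hx
    obtain ⟨hx2, hx1⟩ := (hglue x 0).1 (by rw [hx, map_zero])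
    have : x ∈ S1 ⊓ S2 := ⟨by simpa using hx1, hx2⟩
    rwa [disj, Submodule.mem_bot] at this
  · rw [LinearMap.range_comp, LinearMap.range_comp, ← Submodule.map_sup,
      LinearMap.sup_range_inl_inr, Submodule.map_top, Submodule.range_mkQ]

end Glue

/-- Over a right `n`-Nakayama ring, an indecomposable module with two maximal submodules has
length at most `n`. -/
theorem IsRightNNakayama.length_le {Λ : Type u} [Ring Λ] {n : ℕ} (hΛ : IsRightNNakayama Λ n)
    (X : Type u) [AddCommGroup X] [Module Λᵐᵒᵖ X] [Module.Finite Λᵐᵒᵖ X]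
    (hX : IsIndecModule Λᵐᵒᵖ X) {C D : Submodule Λᵐᵒᵖ X} (hC : IsCoatom C) (hD : IsCoatom D)
    (hCD : C ≠ D) : Module.length Λᵐᵒᵖ X ≤ n := by
  have hcmp : ¬ (C ≤ D ∨ D ≤ C) := by
    rintro (h | h)
    · exact hCD ((hC.le_iff.1 h).resolve_left hD.1).symm
    · exact hCD ((hD.le_iff.1 h).resolve_left hC.1)
  obtain ⟨i, -, hin, ⟨-, hu⟩ | ⟨-, -, l, hl, -, hu, -⟩⟩ :=
    hΛ.1 (ModuleCat.of Λᵐᵒᵖ X) ‹_› hX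
  · exact absurd (hu C D) hcmp
  · rw [moduleLength, ← Module.coe_length] at hl
    have hl' : Module.length Λᵐᵒᵖ X = l := WithBot.coe_injective hl
    rw [hl', Nat.cast_le]
    by_contra hlt
    have hli : 1 ≤ l - i := by omega
    exact hcmp ((isUniserialModule_quotient_iff _).1 hu C D (radPow_le_of_isCoatom hC hli)
      (radPow_le_of_isCoatom hD hli))

theorem structure_of_local_two_factor_serial
    (R : Type*) [CommRing R] [IsArtinianRing R]
    (Λ : Type u) [Ring Λ] [Algebra R Λ] [Module.Finite R Λ]
    (hΛ : IsRightNNakayama Λ 4)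
    (M : Type u) [AddCommGroup M] [Module Λᵐᵒᵖ M] [Module.Finite Λᵐᵒᵖ M]
    (hind : IsIndecModule Λᵐᵒᵖ M) (hfs : IsNFactorSerial Λᵐᵒᵖ M 2)
    (hloc : IsLocalModule Λᵐᵒᵖ M) :
    moduleLength Λᵐᵒᵖ M = (3 : ℕ) ∧
    ∃ S1 S2 : Submodule Λᵐᵒᵖ M, IsAtom S1 ∧ IsAtom S2 ∧ S1 ≠ S2 ∧
      radPow Λᵐᵒᵖ M 1 = moduleSoc Λᵐᵒᵖ M ∧ moduleSoc Λᵐᵒᵖ M = S1 ⊔ S2 := by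
  obtain ⟨k, S1, S2, hl, hS1, hS2, hne, hc1, hc2, hr, hcmp, hlt⟩ := hfs.exists_radPow_eq_sup
  obtain ⟨_, _⟩ := isNoetherian_and_isArtinian_of_moduleLength hl
  obtain ⟨N, hN, huniq⟩ := hloc
  have hsoc : moduleSoc Λᵐᵒᵖ M = S1 ⊔ S2 := by
    refine le_antisymm (sSup_le fun P hP => ?_) (sup_le (le_sSup hS1) (le_sSup hS2))
    rw [← hr]
    refine (hcmp P).elim id fun hle => ?_
    rcases hP.le_iff.1 (hc1.le.trans hle) with h | h
    · exact absurd h hS1.1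
    · exact h ▸ hc1.le
  have hk0 : k ≠ 0 := by
    rintro rfl
    exact hne ((huniq S1 (covBy_top_iff.1 hc1)).trans (huniq S2 (covBy_top_iff.1 hc2)).symm)
  have hrad : radPow Λᵐᵒᵖ M 1 = N :=
    le_antisymm (radPow_le_of_isCoatom hN le_rfl)
      (le_radOf le_top fun C hC => (huniq C (covBy_top_iff.1 hC)).ge)
  obtain rfl : k = 1 := by
    by_contra hk1
    have hrN : radPow Λᵐᵒᵖ M k < N := by
      rw [← hrad]
      exact (radPow_antitone (show 2 ≤ k by omega)).trans_lt (hlt 1 (by omega))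
    obtain ⟨L, hL, -⟩ := exists_covBy_le_of_lt hrN
    obtain ⟨K, i, j, hg⟩ := exists_isGluing hcmp hr (hS1.disjoint_of_ne hS2 hne).eq_bot hS1.1
      hS2.1 hL
    have hNJ : N ≤ Module.jacobson Λᵐᵒᵖ M := le_sInf fun C hC => (huniq C hC).ge
    obtain ⟨C, D, hC, hD, hCD⟩ := hg.exists_isCoatom_ne hrN hN
    have hle := hΛ.length_le _ (hg.isIndecModule hN hrN hNJ) hC hD hCD
    have hadd := Module.length_eq_add_of_exact i (LinearMap.range i).mkQ hg.inj
      (Submodule.mkQ_surjective _) (LinearMap.exact_map_mkQ_range i)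
    have : Nontrivial (((M × L) ⧸ K) ⧸ LinearMap.range i) :=
      Submodule.Quotient.nontrivial_iff.2 hg.isCoatom_range.1
    have hpos : 1 ≤ Module.length Λᵐᵒᵖ (((M × L) ⧸ K) ⧸ LinearMap.range i) :=
      Order.one_le_iff_pos.2 Module.length_pos
    rw [moduleLength, ← Module.coe_length] at hl
    have hM : Module.length Λᵐᵒᵖ M = (k + 2 : ℕ) := WithBot.coe_injective hl
    have h5 : ((k + 3 : ℕ) : ℕ∞) ≤ (4 : ℕ) := by
      refine le_trans ?_ hle
      rw [hadd, hM]
      calc ((k + 3 : ℕ) : ℕ∞) = ((k + 2 : ℕ) : ℕ∞) + 1 := by push_cast; ring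
        _ ≤ _ := by gcongr
    have := Nat.cast_le.1 h5
    omega
  exact ⟨hl, S1, S2, hS1, hS2, hne, by rw [hsoc, hr], hsoc⟩
end

section
/- Let Λ be a right 4-Nakayama artin algebra and let P be an indecomposable projective 2-factor serial right Λ-module with rad(P) = soc(P) = S1 ⊕ S2, where S1 and S2 are simple submodules of P. Assume that P is not isomorphic to a submodule of any indecomposable non-local 4-factor serial right Λ-module whose socle is not simple. Then for each i ∈ {1, 2} the short exact sequence 0 → S_i → P → P/S_i → 0, whose maps are the inclusion of S_i into P and the canonical projection P → P/S_i, is an almost split sequence. -/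
/-! Basic definitions for (right) modules over a ring: radical, socle, length,
uniserial, local, indecomposable, `n`-factor serial, right `n`-Nakayama algebras,
Nakayama algebras and almost split sequences. -/

universe u v w

section Helpers

variable {A : Type v} [Ring A]

lemma radPow_one_eq (M : Type w) [AddCommGroup M] [Module A M] :
    radPow A M 1 = moduleRad A M := by
  have key : ∀ N : Submodule A M,
      IsCoatom N ↔ IsCoatom (N.comap (⊤ : Submodule A M).subtype) := fun N =>
    (OrderIso.isCoatom_iff (Submodule.orderIsoMapComap (Submodule.topEquiv (R := A) (M := M))).symm
      N).symm
  apply le_antisymm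
  · refine le_sInf fun N hN => ?_
    refine Submodule.map_le_iff_le_comap.2 (sInf_le ((key N).1 hN))
  · intro x hx
    refine ⟨⟨x, trivial⟩, ?_, rfl⟩
    refine Submodule.mem_sInf.2 fun N hN => ?_
    have h : (N.map (⊤ : Submodule A M).subtype).comap (⊤ : Submodule A M).subtype = N :=
      Submodule.comap_map_eq_of_injective (Submodule.subtype_injective _) N
    have hc : IsCoatom (N.map (⊤ : Submodule A M).subtype) := by
      rw [key, h]; exact hN
    have := Submodule.mem_sInf.1 hx _ hc
    rw [← h]
    exact this

lemma radPow_le_one (M : Type w) [AddCommGroup M] [Module A M] {n : ℕ} (hn : 1 ≤ n) :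
    radPow A M n ≤ radPow A M 1 := by
  induction n, hn using Nat.le_induction with
  | base => exact le_rfl
  | succ n _ ih => exact (Submodule.map_subtype_le _ _).trans ih

/-- A finitely generated nonzero module with a uniserial quotient by a submodule of the radical
is local. -/
lemma isLocalModule_of_uniserial_quotient {M : Type w} [AddCommGroup M] [Module A M]
    [Module.Finite A M] [Nontrivial M] {U : Submodule A M} (hU : U ≤ moduleRad A M)
    (h : IsUniserialModule A (M ⧸ U)) : IsLocalModule A M := by
  obtain ⟨N, hN, -⟩ := (eq_top_or_exists_le_coatom (⊥ : Submodule A M)).resolve_left bot_ne_top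
  refine ⟨N, hN, fun N' hN' => ?_⟩
  have hc : ∀ Q : Submodule A M, IsCoatom Q → (Q.map U.mkQ).comap U.mkQ = Q := fun Q hQ => by
    rw [Submodule.comap_map_mkQ]
    exact sup_eq_right.2 (hU.trans (sInf_le hQ))
  rcases h (N.map U.mkQ) (N'.map U.mkQ) with h | h
  · have := Submodule.comap_mono (f := U.mkQ) h
    rw [hc N hN, hc N' hN'] at this
    exact ((hN.le_iff.1 this).resolve_left hN'.1)
  · have := Submodule.comap_mono (f := U.mkQ) h
    rw [hc N hN, hc N' hN'] at this
    exact ((hN'.le_iff.1 this).resolve_left hN.1).symm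

lemma IsUniserialModule.isLocalModule {M : Type w} [AddCommGroup M] [Module A M]
    [Module.Finite A M] [Nontrivial M] (h : IsUniserialModule A M) : IsLocalModule A M := by
  refine isLocalModule_of_uniserial_quotient (U := ⊥) bot_le fun N Q => ?_
  rcases h (N.comap (Submodule.mkQ ⊥)) (Q.comap (Submodule.mkQ ⊥)) with h | h
  · exact Or.inl ((Submodule.comap_le_comap_iff_of_surjective
      (Submodule.mkQ_surjective _)).1 h)
  · exact Or.inr ((Submodule.comap_le_comap_iff_of_surjective
      (Submodule.mkQ_surjective _)).1 h)

/-- A finitely generated nonlocal `n`-factor serial module has length `n`. -/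
lemma IsNFactorSerial.length_eq {M : Type w} [AddCommGroup M] [Module A M]
    [Module.Finite A M] [Nontrivial M] {n : ℕ} (h : IsNFactorSerial A M n)
    (hloc : ¬ IsLocalModule A M) : Module.length A M = n := by
  obtain ⟨-, -, l, hl, hnl, hu, -⟩ := h
  have hlen : Module.length A M = l := by
    have h1 := Module.coe_length A M
    rw [show Order.krullDim (Submodule A M) = l from hl] at h1
    exact_mod_cast h1
  rcases hnl.eq_or_lt with rfl | hlt
  · exact hlen
  · exact absurd (isLocalModule_of_uniserial_quotient
      ((radPow_le_one M (by omega)).trans (radPow_one_eq M).le) hu) hloc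

lemma IsLocalModule.le_or_eq_top {M : Type w} [AddCommGroup M] [Module A M]
    [Module.Finite A M] (h : IsLocalModule A M) (N : Submodule A M) :
    N ≤ moduleRad A M ∨ N = ⊤ := by
  obtain ⟨Q, hQ, hu⟩ := h
  rcases eq_top_or_exists_le_coatom N with h | ⟨T, hT, hNT⟩
  · exact Or.inr h
  · refine Or.inl (le_sInf fun T' hT' => ?_)
    rw [hu T' hT', ← hu T hT]
    exact hNT

lemma moduleRad_ne_top {M : Type w} [AddCommGroup M] [Module A M]
    [Module.Finite A M] [Nontrivial M] : moduleRad A M ≠ ⊤ := by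
  obtain ⟨N, hN, -⟩ := (eq_top_or_exists_le_coatom (⊥ : Submodule A M)).resolve_left bot_ne_top
  exact fun h => hN.1 (top_le_iff.1 (h ▸ sInf_le hN))

lemma IsLocalModule.eq_top_of_sup {M : Type w} [AddCommGroup M] [Module A M]
    [Module.Finite A M] [Nontrivial M] (h : IsLocalModule A M) {N Q : Submodule A M}
    (hs : N ⊔ Q = ⊤) : N = ⊤ ∨ Q = ⊤ := by
  rcases h.le_or_eq_top N with hN | hN
  · rcases h.le_or_eq_top Q with hQ | hQ
    · exact absurd (top_le_iff.1 (hs ▸ sup_le hN hQ)) moduleRad_ne_top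
    · exact Or.inr hQ
  · exact Or.inl hN

lemma isAtom_map_of_injective {M N : Type*} [AddCommGroup M] [Module A M] [AddCommGroup N]
    [Module A N] {f : M →ₗ[A] N} (hf : Function.Injective f) {S : Submodule A M}
    (hS : IsAtom S) : IsAtom (S.map f) := by
  rw [← isSimpleModule_iff_isAtom] at hS ⊢
  exact IsSimpleModule.congr (Submodule.equivMapOfInjective f hf S).symm

/-- Two distinct simple submodules are preserved by an injective map, so its target is not
colocal. -/
lemma not_isColocalModule_of_injective {M N : Type*} [AddCommGroup M] [Module A M]
    [AddCommGroup N] [Module A N] {f : M →ₗ[A] N} (hf : Function.Injective f)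
    {S T : Submodule A M} (hS : IsAtom S) (hT : IsAtom T) (hne : S ≠ T) :
    ¬ IsColocalModule A N := fun h => by
  have key : ∀ S : Submodule A M, IsAtom S → S.map f = moduleSoc A N := fun S hS =>
    (h.le_iff.1 (le_sSup (isAtom_map_of_injective hf hS))).resolve_left
      (isAtom_map_of_injective hf hS).1
  exact hne (Submodule.map_injective_of_injective hf ((key S hS).trans (key T hT).symm))

/-- If lifting through `g` is possible for maps from indecomposable modules, then it is possible
for maps from any module of finite length. -/
lemma exists_lift_of_indecomposable {Y Z : Type w} [AddCommGroup Y] [Module A Y]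
    [AddCommGroup Z] [Module A Z] [IsArtinianRing A] (g : Y →ₗ[A] Z)
    (H : ∀ V : Type w, ∀ [AddCommGroup V] [Module A V], Module.Finite A V →
      IsIndecModule A V → ∀ h : V →ₗ[A] Z,
      (¬ ∃ s : Z →ₗ[A] V, h ∘ₗ s = LinearMap.id) → ∃ k : V →ₗ[A] Y, g ∘ₗ k = h)
    (V : Type w) [AddCommGroup V] [Module A V] [Module.Finite A V] (h : V →ₗ[A] Z)
    (hs : ¬ ∃ s : Z →ₗ[A] V, h ∘ₗ s = LinearMap.id) : ∃ k : V →ₗ[A] Y, g ∘ₗ k = h := by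
  induction hn : Module.length A V using WellFoundedLT.induction generalizing V with
  | ind n ih =>
  subst hn
  by_cases hV : IsIndecModule A V
  · exact H V inferInstance hV h hs
  rcases subsingleton_or_nontrivial V with hsub | hnt
  · exact ⟨0, LinearMap.ext fun x => by simp [Subsingleton.elim x 0]⟩
  simp only [IsIndecModule, hnt, true_and, not_forall, not_or] at hV
  obtain ⟨N, Q, hNQ, hN, hQ⟩ := hV
  have hfin : ∀ T : Submodule A V, T ≠ ⊤ → ∃ k : T →ₗ[A] Y, g ∘ₗ k = h ∘ₗ T.subtype := by
    intro T hT
    refine ih _ (Submodule.length_lt hT) T (h ∘ₗ T.subtype) ?_ rfl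
    rintro ⟨s, hs'⟩
    exact hs ⟨T.subtype ∘ₗ s, hs'⟩
  obtain ⟨k₁, hk₁⟩ := hfin N fun h => hQ (by simpa [h] using hNQ.inf_eq_bot)
  obtain ⟨k₂, hk₂⟩ := hfin Q fun h => hN (by simpa [h] using hNQ.inf_eq_bot)
  refine ⟨LinearMap.ofIsCompl hNQ k₁ k₂, ?_⟩
  rw [← LinearMap.ofIsCompl_eq' hNQ hk₁ hk₂]
  symm
  apply LinearMap.ofIsCompl_eq <;> intro u <;> simp

end Helpers

section Projective

variable {A : Type v} [Ring A] {P : Type w} [AddCommGroup P] [Module A P]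

/-- A map to `P ⧸ S` whose image lies in that of a submodule disjoint from `S` lifts to `P`. -/
lemma exists_lift_of_range_le {V : Type*} [AddCommGroup V] [Module A V] {S T : Submodule A P}
    (hST : Disjoint S T) (h : V →ₗ[A] P ⧸ S) (hr : LinearMap.range h ≤ T.map S.mkQ) :
    ∃ k : V →ₗ[A] P, S.mkQ ∘ₗ k = h := by
  have hinj : Function.Injective (S.mkQ ∘ₗ T.subtype) := by
    rw [← LinearMap.ker_eq_bot, LinearMap.ker_comp, Submodule.ker_mkQ,
      ← Submodule.disjoint_iff_comap_eq_bot]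
    exact hST.symm
  have hr' : ∀ v, h v ∈ LinearMap.range (S.mkQ ∘ₗ T.subtype) := fun v => by
    rw [LinearMap.range_comp, Submodule.range_subtype]
    exact hr ⟨v, rfl⟩
  let e := LinearEquiv.ofInjective _ hinj
  refine ⟨T.subtype ∘ₗ e.symm.toLinearMap ∘ₗ h.codRestrict _ hr', LinearMap.ext fun v => ?_⟩
  have := congrArg Subtype.val (e.apply_symm_apply (h.codRestrict _ hr' v))
  exact this

/-- A map onto `P ⧸ S` from an indecomposable module either splits or comes from an embedding of
the projective module `P`. -/
lemma exists_injective_of_surjective {V : Type*} [AddCommGroup V] [Module A V]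
    [Module.Projective A P] {S : Submodule A P} (hS : IsAtom S) (h : V →ₗ[A] P ⧸ S)
    (hsurj : Function.Surjective h) (hs : ¬ ∃ s : (P ⧸ S) →ₗ[A] V, h ∘ₗ s = LinearMap.id) :
    ∃ p : P →ₗ[A] V, h ∘ₗ p = S.mkQ ∧ Function.Injective p := by
  obtain ⟨p, hp⟩ := Module.projective_lifting_property h S.mkQ hsurj
  refine ⟨p, hp, ?_⟩
  rw [← LinearMap.ker_eq_bot]
  have hle : LinearMap.ker p ≤ S := by
    rw [← S.ker_mkQ, ← hp]
    exact LinearMap.ker_le_ker_comp p h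
  refine (hS.le_iff.1 hle).resolve_right fun he => hs ⟨S.liftQ p he.ge, ?_⟩
  apply Submodule.linearMap_qext
  rw [LinearMap.comp_assoc, Submodule.liftQ_mkQ, hp, LinearMap.id_comp]

end Projective

theorem almost_split_sequence_of_projective_two_factor_serial
    (R : Type*) [CommRing R] [IsArtinianRing R]
    (Λ : Type u) [Ring Λ] [Algebra R Λ] [Module.Finite R Λ]
    (hΛ : IsRightNNakayama Λ 4)
    (P : Type u) [AddCommGroup P] [Module Λᵐᵒᵖ P] [Module.Finite Λᵐᵒᵖ P]
    [Module.Projective Λᵐᵒᵖ P]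
    (hind : IsIndecModule Λᵐᵒᵖ P) (hfs : IsNFactorSerial Λᵐᵒᵖ P 2)
    (S1 S2 : Submodule Λᵐᵒᵖ P) (hS1 : IsAtom S1) (hS2 : IsAtom S2) (hne : S1 ≠ S2)
    (hrad : radPow Λᵐᵒᵖ P 1 = S1 ⊔ S2) (hsoc : moduleSoc Λᵐᵒᵖ P = S1 ⊔ S2)
    (hnotsub : ¬ ∃ L : ModuleCat.{u} Λᵐᵒᵖ, Module.Finite Λᵐᵒᵖ L ∧
      IsIndecModule Λᵐᵒᵖ L ∧ ¬ IsLocalModule Λᵐᵒᵖ L ∧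
      IsNFactorSerial Λᵐᵒᵖ L 4 ∧ ¬ IsColocalModule Λᵐᵒᵖ L ∧
      ∃ f : P →ₗ[Λᵐᵒᵖ] L, Function.Injective f) :
    ∀ S : Submodule Λᵐᵒᵖ P, S = S1 ∨ S = S2 →
      IsAlmostSplitSequence S.subtype S.mkQ := by
  have : Module.Finite R Λᵐᵒᵖ := Module.Finite.equiv (MulOpposite.opLinearEquiv R)
  have : IsArtinianRing Λᵐᵒᵖ := IsArtinianRing.of_finite R Λᵐᵒᵖ
  have : Nontrivial P := hind.1
  rw [radPow_one_eq] at hrad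
  have hlen : 3 ≤ Module.length Λᵐᵒᵖ P := by
    have h1 : Order.height S1 + 1 ≤ Order.height (S1 ⊔ S2) :=
      Order.height_add_one_le (left_lt_sup.2 fun h => hne
        ((hS1.le_iff.1 h).resolve_left hS2.1).symm)
    have h2 : Order.height (S1 ⊔ S2) + 1 ≤ Order.height (⊤ : Submodule Λᵐᵒᵖ P) :=
      Order.height_add_one_le (hrad ▸ moduleRad_ne_top.lt_top)
    have h0 : Order.height (⊥ : Submodule Λᵐᵒᵖ P) + 1 ≤ Order.height S1 :=
      Order.height_add_one_le hS1.bot_lt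
    rw [Module.length_eq_height]
    calc (3 : ℕ∞) = 0 + 1 + 1 + 1 := by norm_num
      _ ≤ Order.height (⊥ : Submodule Λᵐᵒᵖ P) + 1 + 1 + 1 := by gcongr; exact zero_le
      _ ≤ Order.height S1 + 1 + 1 := by gcongr
      _ ≤ Order.height (S1 ⊔ S2) + 1 := by gcongr
      _ ≤ _ := h2
  have hloc : IsLocalModule Λᵐᵒᵖ P := by
    by_contra hloc
    rw [hfs.length_eq hloc] at hlen
    exact absurd hlen (by decide)
  suffices main : ∀ S T : Submodule Λᵐᵒᵖ P, IsAtom S → IsAtom T → S ≠ T →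
      moduleRad Λᵐᵒᵖ P = S ⊔ T → IsAlmostSplitSequence S.subtype S.mkQ by
    rintro S (rfl | rfl)
    · exact main _ _ hS1 hS2 hne hrad
    · exact main _ _ hS2 hS1 hne.symm (by rw [hrad, sup_comm])
  intro S T hS hT hST hrad
  have hStop : S ≠ ⊤ := fun h => moduleRad_ne_top (top_le_iff.1 (h ▸ le_sup_left.trans hrad.ge))
  have : Nontrivial (P ⧸ S) := Submodule.Quotient.nontrivial_iff.2 hStop
  refine ⟨S.subtype_injective, S.mkQ_surjective, by simp, ?_, ?_, ⟨inferInstance, ?_⟩, ?_⟩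
  · rintro ⟨s, hs⟩
    have hs' : ∀ z, S.mkQ (s z) = z := LinearMap.congr_fun hs
    have hc : IsCompl S (LinearMap.range s) := by
      refine ⟨Submodule.disjoint_def.2 ?_, codisjoint_iff.2 (Submodule.eq_top_iff'.2 fun x => ?_)⟩
      · rintro _ hx ⟨z, rfl⟩
        rw [← hs' z, (by simpa using hx : S.mkQ (s z) = 0), map_zero]
      · refine Submodule.mem_sup.2 ⟨x - s (S.mkQ x), ?_, _, ⟨S.mkQ x, rfl⟩, by abel⟩
        refine S.ker_mkQ.le (LinearMap.mem_ker.2 ?_)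
        rw [map_sub, hs', sub_self]
    rcases hind.2 _ _ hc with h | h
    · exact hS.1 h
    · exact hStop (by simpa [h] using hc.sup_eq_top)
  · have := isSimpleModule_iff_isAtom.2 hS
    refine ⟨IsSimpleModule.nontrivial Λᵐᵒᵖ S, fun N Q hNQ => ?_⟩
    rcases eq_bot_or_eq_top N with h | h
    · exact Or.inl h
    · exact Or.inr (by simpa [h] using hNQ.inf_eq_bot)
  · intro N Q hNQ
    have hsup : N.comap S.mkQ ⊔ Q.comap S.mkQ = ⊤ := by
      rw [← Submodule.comap_map_eq_self (f := S.mkQ) (p := N.comap S.mkQ ⊔ Q.comap S.mkQ)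
        (by
          rw [Submodule.ker_mkQ]
          exact (Submodule.le_comap_mkQ S N).trans le_sup_left),
        Submodule.map_sup, Submodule.map_comap_eq_of_surjective S.mkQ_surjective,
        Submodule.map_comap_eq_of_surjective S.mkQ_surjective, hNQ.sup_eq_top, Submodule.comap_top]
    have key : ∀ N : Submodule Λᵐᵒᵖ (P ⧸ S), N.comap S.mkQ = ⊤ → N = ⊤ := fun N h =>
      Submodule.comap_injective_of_surjective S.mkQ_surjective (by simpa using h)
    rcases hloc.eq_top_of_sup hsup with h | h
    · exact Or.inr (by simpa [key N h] using hNQ.inf_eq_bot)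
    · exact Or.inl (by simpa [key Q h] using hNQ.inf_eq_bot)
  intro V hV h hs
  refine exists_lift_of_indecomposable S.mkQ ?_ V h hs
  clear! V
  intro V _ _ hV hVind h hs
  have : Nontrivial V := hVind.1
  by_cases hsurj : Function.Surjective h
  swap
  · refine exists_lift_of_range_le (hS.disjoint_of_ne hT hST) h ?_
    have hle := (hloc.le_or_eq_top ((LinearMap.range h).comap S.mkQ)).resolve_right fun ht =>
      hsurj (LinearMap.range_eq_top.1
        (Submodule.comap_injective_of_surjective S.mkQ_surjective (by simpa using ht)))
    rw [hrad] at hle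
    have := Submodule.map_mono (f := S.mkQ) hle
    rwa [Submodule.map_comap_eq_of_surjective S.mkQ_surjective, Submodule.map_sup,
      Submodule.mkQ_map_self, bot_sup_eq] at this
  obtain ⟨p, hp, hinj⟩ := exists_injective_of_surjective hS h hsurj hs
  suffices hps : Function.Surjective p by
    let e := LinearEquiv.ofBijective p ⟨hinj, hps⟩
    refine ⟨e.symm.toLinearMap, LinearMap.ext fun v => ?_⟩
    rw [← hp]
    exact congrArg h (e.apply_symm_apply v)
  rw [← LinearMap.range_eq_top]
  by_contra hps
  have hVloc : ¬ IsLocalModule Λᵐᵒᵖ V := by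
    intro hl
    have hsup : LinearMap.range p ⊔ LinearMap.ker h = ⊤ := by
      refine Submodule.eq_top_iff'.2 fun v => ?_
      obtain ⟨x, hx⟩ := S.mkQ_surjective (h v)
      refine Submodule.mem_sup.2 ⟨p x, ⟨x, rfl⟩, v - p x, ?_, by abel⟩
      rw [LinearMap.mem_ker, map_sub, ← LinearMap.comp_apply, hp, hx, sub_self]
    refine (hl.eq_top_of_sup hsup).elim hps fun hk => ?_
    obtain ⟨z, hz⟩ := exists_ne (0 : P ⧸ S)
    obtain ⟨v, rfl⟩ := hsurj z
    exact hz (LinearMap.mem_ker.1 (hk ▸ Submodule.mem_top))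
  have hlt : Module.length Λᵐᵒᵖ P < Module.length Λᵐᵒᵖ V := by
    rw [(LinearEquiv.ofInjective p hinj).length_eq]
    exact Submodule.length_lt hps
  obtain ⟨i, -, hi, ⟨-, hu⟩ | hi'⟩ := hΛ.1 (ModuleCat.of Λᵐᵒᵖ V) hV hVind
  · exact hVloc hu.isLocalModule
  have hVlen : Module.length Λᵐᵒᵖ V = i := hi'.length_eq hVloc
  have : i = 4 := by
    have h3 := hlen.trans_lt hlt
    rw [hVlen] at h3
    have : 3 < i := by exact_mod_cast h3
    omega
  subst this
  exact hnotsub ⟨ModuleCat.of Λᵐᵒᵖ V, hV, hVind, hVloc, hi',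
    not_isColocalModule_of_injective hinj hS hT hST, p, hinj⟩
end

section
/- Let Λ be a right 4-Nakayama artin algebra and let M be a finitely generated indecomposable non-local 4-factor serial right Λ-module with simple socle. Let M1 and M2 be the two maximal submodules of M (of length 3), where M1 is uniserial and M2 is non-local 3-factor serial, and let N1 = M1 ∩ M2, a uniserial submodule of length 2. Then the short exact sequence 0 → N1 → M1 ⊕ M2 → M → 0, where the first map sends x to (x, x) and the second map sends (m1, m2) to m2 − m1, is an almost split sequence. -/
/-! Basic definitions for (right) modules over a ring: radical, socle, length,
uniserial, local, indecomposable, `n`-factor serial, right `n`-Nakayama algebras,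
Nakayama algebras and almost split sequences. -/

universe u v w

section AlmostSplitAux

variable {A : Type v} [Ring A]

theorem length_eq_of_moduleLength_eq {M : Type w} [AddCommGroup M] [Module A M] {n : ℕ}
    (h : moduleLength A M = n) : Module.length A M = n := by
  rw [moduleLength, ← Module.coe_length] at h
  exact WithBot.coe_injective h

theorem radOf_top_le_of_isCoatom {M : Type w} [AddCommGroup M] [Module A M]
    {C : Submodule A M} (hC : IsCoatom C) : radOf (⊤ : Submodule A M) ≤ C := by
  have hsurj : Function.Surjective (⊤ : Submodule A M).subtype := fun x => ⟨⟨x, trivial⟩, rfl⟩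
  exact Submodule.map_le_iff_le_comap.2
    (sInf_le ((Submodule.isCoatom_comap_iff hsurj).2 hC))

theorem radPow_succ_le_of_isCoatom {M : Type w} [AddCommGroup M] [Module A M]
    {C : Submodule A M} (hC : IsCoatom C) (n : ℕ) : radPow A M (n + 1) ≤ C := by
  induction n with
  | zero => exact radOf_top_le_of_isCoatom hC
  | succ n ih => exact (Submodule.map_subtype_le _ _).trans ih

/-- A module with two distinct maximal submodules has no uniserial quotient by a
positive power of its radical. -/
theorem eq_zero_of_isUniserialModule_quotient_radPow {M : Type w} [AddCommGroup M] [Module A M]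
    {C D : Submodule A M} (hC : IsCoatom C) (hD : IsCoatom D) (hne : C ≠ D) {n : ℕ}
    (hu : IsUniserialModule A (M ⧸ radPow A M n)) : n = 0 := by
  rcases n with _ | n
  · rfl
  have key : ∀ {X Y : Submodule A M}, IsCoatom X → IsCoatom Y →
      X.map (radPow A M (n + 1)).mkQ ≤ Y.map (radPow A M (n + 1)).mkQ → X = Y := by
    intro X Y hX hY h
    have hle : X ≤ Y := by
      rw [Submodule.map_le_iff_le_comap, Submodule.comap_map_mkQ] at h
      exact h.trans (sup_le (radPow_succ_le_of_isCoatom hY n) le_rfl)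
    exact ((hX.le_iff.1 hle).resolve_left hY.1).symm
  rcases hu (C.map (radPow A M (n + 1)).mkQ) (D.map (radPow A M (n + 1)).mkQ) with h | h
  · exact (hne (key hC hD h)).elim
  · exact (hne (key hD hC h).symm).elim

/-- An `i`-factor serial module with two distinct maximal submodules has length `i`. -/
theorem IsFactorSerial.moduleLength_eq {M : Type w} [AddCommGroup M] [Module A M]
    {C D : Submodule A M} (hC : IsCoatom C) (hD : IsCoatom D) (hne : C ≠ D) {i : ℕ}
    (h : IsFactorSerial A M i) : moduleLength A M = i := by
  rcases h with ⟨-, hu⟩ | ⟨-, -, l, hl, hil, hu, -⟩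
  · rcases hu C D with h | h
    · exact (hne ((hC.le_iff.1 h).resolve_left hD.1).symm).elim
    · exact (hne ((hD.le_iff.1 h).resolve_left hC.1)).elim
  · have := eq_zero_of_isUniserialModule_quotient_radPow hC hD hne hu
    rw [hl, show l = i by omega]

theorem IsUniserialModule.isIndecModule {M : Type w} [AddCommGroup M] [Module A M]
    [Nontrivial M] (hu : IsUniserialModule A M) : IsIndecModule A M := by
  refine ⟨inferInstance, fun N P h => (hu N P).imp (fun hle => ?_) (fun hle => ?_)⟩
  · exact h.disjoint.eq_bot_of_le hle
  · exact h.disjoint.symm.eq_bot_of_le hle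

/-- Fitting's lemma for indecomposable modules of finite length. -/
theorem IsIndecModule.isNilpotent_or_isUnit {M : Type w} [AddCommGroup M] [Module A M]
    [IsArtinian A M] [IsNoetherian A M] (hM : IsIndecModule A M) (e : Module.End A M) :
    IsNilpotent e ∨ IsUnit e := by
  obtain ⟨n, hn, hn1⟩ := (e.eventually_isCompl_ker_pow_range_pow.and
    (Filter.eventually_ge_atTop 1)).exists
  rcases hM.2 _ _ hn with h | h
  · right
    have hr : LinearMap.range (e ^ n) = ⊤ := by
      have := hn.codisjoint.eq_top
      rwa [h, bot_sup_eq] at this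
    exact (isUnit_pow_iff (by omega)).1
      ((Module.End.isUnit_iff _).2 ⟨LinearMap.ker_eq_bot.1 h, LinearMap.range_eq_top.1 hr⟩)
  · exact Or.inl ⟨n, LinearMap.range_eq_bot.1 h⟩

/-- If `V` has finite length, a map out of `V` that is not a split epimorphism lifts along `g` as
soon as this holds for all indecomposable sources. -/
theorem exists_lift_of_forall_isIndecModule {Y Z : Type w} [AddCommGroup Y] [Module A Y]
    [AddCommGroup Z] [Module A Z] (g : Y →ₗ[A] Z)
    (H : ∀ (V : Type w) [AddCommGroup V] [Module A V] [IsArtinian A V] [IsNoetherian A V],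
      IsIndecModule A V → ∀ h : V →ₗ[A] Z, (¬ ∃ s : Z →ₗ[A] V, h ∘ₗ s = LinearMap.id) →
        ∃ k : V →ₗ[A] Y, g ∘ₗ k = h)
    (V : Type w) [AddCommGroup V] [Module A V] [IsArtinian A V] [IsNoetherian A V]
    (h : V →ₗ[A] Z) (hs : ¬ ∃ s : Z →ₗ[A] V, h ∘ₗ s = LinearMap.id) :
    ∃ k : V →ₗ[A] Y, g ∘ₗ k = h := by
  induction hn : Module.length A V using WellFoundedLT.induction generalizing V with
  | ind n ih =>
  subst hn
  by_cases hV : IsIndecModule A V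
  · exact H V hV h hs
  by_cases hnt : Nontrivial V
  swap
  · rw [not_nontrivial_iff_subsingleton] at hnt
    exact ⟨0, LinearMap.ext fun x => by simp [Subsingleton.elim x 0]⟩
  obtain ⟨N, P, hNP, hN, hP⟩ : ∃ N P : Submodule A V, IsCompl N P ∧ N ≠ ⊥ ∧ P ≠ ⊥ := by
    simpa [IsIndecModule, hnt] using hV
  have lift : ∀ Q : Submodule A V, Q ≠ ⊤ → ∃ k : Q →ₗ[A] Y, g ∘ₗ k = h ∘ₗ Q.subtype :=
    fun Q hQ => ih _ (Submodule.length_lt hQ) Q _ (fun ⟨s, e⟩ => hs ⟨Q.subtype ∘ₗ s, e⟩) rfl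
  obtain ⟨k₁, hk₁⟩ := lift N fun e => hP (by simpa [e] using hNP.disjoint)
  obtain ⟨k₂, hk₂⟩ := lift P fun e => hN (by simpa [e] using hNP.disjoint)
  refine ⟨LinearMap.ofIsCompl hNP k₁ k₂, ?_⟩
  rw [← LinearMap.ofIsCompl_eq' hNP hk₁ hk₂]
  exact (LinearMap.ofIsCompl_eq hNP (by simp) (by simp)).symm

/-- For `i ≤ n`, every epimorphism from an `i`-factor serial module onto a module of length at
least `n` with two distinct maximal submodules is injective. -/
theorem injective_of_surjective_of_isFactorSerial {V Z : Type w} [AddCommGroup V] [Module A V]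
    [IsArtinian A V] [IsNoetherian A V] [AddCommGroup Z] [Module A Z]
    {C D : Submodule A Z} (hC : IsCoatom C) (hD : IsCoatom D) (hne : C ≠ D) {i n : ℕ}
    (hV : IsFactorSerial A V i) (hin : i ≤ n) (hZ : (n : ℕ∞) ≤ Module.length A Z)
    {h : V →ₗ[A] Z} (hh : Function.Surjective h) : Function.Injective h := by
  have hl : moduleLength A V = i :=
    hV.moduleLength_eq ((Submodule.isCoatom_comap_iff hh).2 hC)
      ((Submodule.isCoatom_comap_iff hh).2 hD)
      ((Submodule.comap_injective_of_surjective hh).ne hne)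
  by_contra hi
  have hlt := Submodule.length_quotient_lt (LinearMap.ker h)
    (fun e => hi (LinearMap.ker_eq_bot.1 e))
  rw [(h.quotKerEquivOfSurjective hh).length_eq, length_eq_of_moduleLength_eq hl] at hlt
  exact absurd (hZ.trans_lt hlt) (not_lt.2 (by exact_mod_cast hin))

end AlmostSplitAux

theorem almost_split_sequence_of_nonlocal_four_factor_serial_simple_socle
    (R : Type*) [CommRing R] [IsArtinianRing R]
    (Λ : Type u) [Ring Λ] [Algebra R Λ] [Module.Finite R Λ]
    (hΛ : IsRightNNakayama Λ 4)
    (M : Type u) [AddCommGroup M] [Module Λᵐᵒᵖ M] [Module.Finite Λᵐᵒᵖ M]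
    (hind : IsIndecModule Λᵐᵒᵖ M) (hnl : ¬ IsLocalModule Λᵐᵒᵖ M)
    (hfs : IsNFactorSerial Λᵐᵒᵖ M 4) (hcoloc : IsColocalModule Λᵐᵒᵖ M)
    (M1 M2 : Submodule Λᵐᵒᵖ M) (hM1 : IsCoatom M1) (hM2 : IsCoatom M2) (hne : M1 ≠ M2)
    (honly : ∀ N : Submodule Λᵐᵒᵖ M, IsCoatom N → N = M1 ∨ N = M2)
    (hu1 : IsUniserialModule Λᵐᵒᵖ ↑M1) (hl1 : moduleLength Λᵐᵒᵖ ↑M1 = (3 : ℕ))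
    (hnl2 : ¬ IsLocalModule Λᵐᵒᵖ ↑M2) (hfs2 : IsNFactorSerial Λᵐᵒᵖ ↑M2 3)
    (hl2 : moduleLength Λᵐᵒᵖ ↑M2 = (3 : ℕ))
    (huN : IsUniserialModule Λᵐᵒᵖ ↑(M1 ⊓ M2))
    (hlN : moduleLength Λᵐᵒᵖ ↑(M1 ⊓ M2) = (2 : ℕ)) :
    IsAlmostSplitSequence
      (LinearMap.prod
        (Submodule.inclusion (inf_le_left : M1 ⊓ M2 ≤ M1))
        (Submodule.inclusion (inf_le_right : M1 ⊓ M2 ≤ M2)))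
      ((M2.subtype ∘ₗ LinearMap.snd Λᵐᵒᵖ ↑M1 ↑M2) -
        (M1.subtype ∘ₗ LinearMap.fst Λᵐᵒᵖ ↑M1 ↑M2)) := by
  have : IsArtinianRing Λᵐᵒᵖ := .of_finite R _
  set g : ↥M1 × ↥M2 →ₗ[Λᵐᵒᵖ] M := (M2.subtype ∘ₗ LinearMap.snd Λᵐᵒᵖ ↑M1 ↑M2) -
    (M1.subtype ∘ₗ LinearMap.fst Λᵐᵒᵖ ↑M1 ↑M2)
  have g_apply : ∀ x, g x = (x.2 : M) - x.1 := fun x => rfl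
  have hlen : ((4 : ℕ) : ℕ∞) ≤ Module.length Λᵐᵒᵖ M := by
    obtain ⟨-, -, l, hl, h4, -⟩ := hfs
    rw [length_eq_of_moduleLength_eq hl]
    exact_mod_cast h4
  refine ⟨?_, ?_, ?_, ?_, ?_, hind, ?_⟩
  · intro x y hxy
    exact Submodule.inclusion_injective inf_le_left (congrArg Prod.fst hxy)
  · intro x
    have hx : x ∈ M1 ⊔ M2 := by
      rw [(hM1.codisjoint_of_ne hM2 hne).eq_top]
      trivial
    obtain ⟨a, ha, b, hb, rfl⟩ := Submodule.mem_sup.1 hx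
    exact ⟨(-⟨a, ha⟩, ⟨b, hb⟩), by simp [g_apply, add_comm]⟩
  · ext ⟨⟨a, ha⟩, ⟨b, hb⟩⟩
    rw [LinearMap.mem_ker, g_apply, sub_eq_zero]
    constructor
    · rintro ⟨x, hx⟩
      simp only [LinearMap.prod_apply, Function.prod, Prod.mk.injEq] at hx
      exact (congrArg Subtype.val hx.2).symm.trans (congrArg Subtype.val hx.1)
    · rintro (rfl : b = a)
      exact ⟨⟨b, ha, hb⟩, rfl⟩
  · rintro ⟨s, hs⟩
    have not_unit : ∀ (N : Submodule Λᵐᵒᵖ M), IsCoatom N → ∀ t : M →ₗ[Λᵐᵒᵖ] N,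
        ¬ IsUnit (N.subtype ∘ₗ t : Module.End Λᵐᵒᵖ M) := by
      intro N hN t ht
      refine hN.1 (eq_top_iff.2 fun x _ => ?_)
      obtain ⟨y, rfl⟩ := ((Module.End.isUnit_iff _).1 ht).2 x
      exact (t y).2
    set e : Module.End Λᵐᵒᵖ M := M1.subtype ∘ₗ LinearMap.fst Λᵐᵒᵖ ↑M1 ↑M2 ∘ₗ s
    set f : Module.End Λᵐᵒᵖ M := M2.subtype ∘ₗ LinearMap.snd Λᵐᵒᵖ ↑M1 ↑M2 ∘ₗ s
    have hef : f = 1 + e := by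
      rw [← sub_eq_iff_eq_add]
      exact hs
    have he := (hind.isNilpotent_or_isUnit e).resolve_right (not_unit M1 hM1 _)
    exact not_unit M2 hM2 _ (hef ▸ he.isUnit_one_add)
  · have : Nontrivial ↥(M1 ⊓ M2) := by
      rw [← Module.length_pos_iff (R := Λᵐᵒᵖ)]
      simp [length_eq_of_moduleLength_eq hlN]
    exact huN.isIndecModule
  · intro V _ h hs
    refine exists_lift_of_forall_isIndecModule g ?_ V h hs
    intro V _ _ _ _ hV h hs
    have hr : ¬ Function.Surjective h := by
      intro hsurj
      obtain ⟨i, -, hi, hVi⟩ := hΛ.1 (ModuleCat.of Λᵐᵒᵖ V) inferInstance hV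
      have hinj := injective_of_surjective_of_isFactorSerial hM1 hM2 hne hVi hi hlen hsurj
      exact hs ⟨(LinearEquiv.ofBijective h ⟨hinj, hsurj⟩).symm,
        LinearMap.ext (LinearEquiv.ofBijective h ⟨hinj, hsurj⟩).apply_symm_apply⟩
    obtain ⟨N, hN, hle⟩ := (eq_top_or_exists_le_coatom (LinearMap.range h)).resolve_left
      fun e => hr (LinearMap.range_eq_top.1 e)
    rw [LinearMap.range_le_iff_comap] at hle
    have hmem : ∀ x, h x ∈ N := fun x => (hle ▸ Submodule.mem_top : x ∈ N.comap h)
    rcases honly N hN with rfl | rfl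
    · exact ⟨LinearMap.inl _ _ _ ∘ₗ (-h.codRestrict N hmem),
        LinearMap.ext fun x => by simp [g_apply]⟩
    · exact ⟨LinearMap.inr _ _ _ ∘ₗ h.codRestrict N hmem,
        LinearMap.ext fun x => by simp [g_apply]⟩
end
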